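/- Let S ⊆ B(H) and T ⊆ B(K) be operator systems, and equip the algebraic tensor product S ⊗ T with the commuting partial product m and the factorization norms ‖·‖_n^c (the infimum of products of norms over permissible factorizations whose factors are matrices with all entries in S⊗ℂ1_T or all entries in ℂ1_S⊗T). Then there exist a complex Hilbert space L and a linear map π : S ⊗ T → B(L) such that π(1_S⊗1_T) = I_L, ‖π^{(n)}(A)‖ = ‖A‖_n^c for all n and A ∈ M_n(S⊗T), and for all s ∈ S, t ∈ T: π(s⊗t) = π(s⊗1_T)π(1_S⊗t) = π(1_S⊗t)π(s⊗1_T) and π(s⊗t)^* = π(s^*⊗t^*). -/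

import Mathlib

set_option synthInstance.maxHeartbeats 1000000
set_option maxHeartbeats 1000000

noncomputable section

open scoped BigOperators TensorProduct

/-- A matrix over `B(E)` viewed as a bounded operator between the `ℓ²`-direct sums `E^κ → E^ι`. -/
noncomputable def opMatCLM {E : Type} [NormedAddCommGroup E] [InnerProductSpace ℂ E]
    {ι κ : Type} [Fintype ι] [Fintype κ] (A : Matrix ι κ (E →L[ℂ] E)) :
    PiLp 2 (fun _ : κ => E) →L[ℂ] PiLp 2 (fun _ : ι => E) :=
  ((PiLp.continuousLinearEquiv 2 ℂ (fun _ : ι => E)).symm.toContinuousLinearMap) ∘L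
    (ContinuousLinearMap.pi fun i => ∑ j, (A i j).comp (ContinuousLinearMap.proj j)) ∘L
    ((PiLp.continuousLinearEquiv 2 ℂ (fun _ : κ => E)).toContinuousLinearMap)

/-- The operator norm of a matrix over `B(E)`, viewed as an operator `E^κ → E^ι`. -/
noncomputable def opMatNorm {E : Type} [NormedAddCommGroup E] [InnerProductSpace ℂ E]
    {ι κ : Type} [Fintype ι] [Fintype κ] (A : Matrix ι κ (E →L[ℂ] E)) : ℝ := ‖opMatCLM A‖

/-- The norm of a matrix over a subspace `X ⊆ B(E)`, computed in `B(E)`. -/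
noncomputable def subMatNorm {E : Type} [NormedAddCommGroup E] [InnerProductSpace ℂ E]
    {X : Submodule ℂ (E →L[ℂ] E)} {ι κ : Type} [Fintype ι] [Fintype κ]
    (A : Matrix ι κ ↥X) : ℝ := opMatNorm (A.map (fun v => (v : E →L[ℂ] E)))

variable {H K : Type}
  [NormedAddCommGroup H] [InnerProductSpace ℂ H] [CompleteSpace H]
  [NormedAddCommGroup K] [InnerProductSpace ℂ K] [CompleteSpace K]

variable (S : Submodule ℂ (H →L[ℂ] H)) (T : Submodule ℂ (K →L[ℂ] K))

/-- The subspace `S ⊗ ℂ1_T` of the algebraic tensor product, consisting of the elementary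
tensors `s ⊗ 1_T`. -/
def leftSlice (t1 : ↥T) : Submodule ℂ (↥S ⊗[ℂ] ↥T) :=
  LinearMap.range ((TensorProduct.mk ℂ ↥S ↥T).flip t1)

/-- The subspace `ℂ1_S ⊗ T` of the algebraic tensor product, consisting of the elementary
tensors `1_S ⊗ t`. -/
def rightSlice (s1 : ↥S) : Submodule ℂ (↥S ⊗[ℂ] ↥T) :=
  LinearMap.range (TensorProduct.mk ℂ ↥S ↥T s1)

section SliceExtraction
open Classical

/-- Extract `s` from an element `s ⊗ 1_T` of `S ⊗ ℂ1_T` (and `0` elsewhere). -/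
noncomputable def sliceS (t1 : ↥T) (a : ↥S ⊗[ℂ] ↥T) : ↥S :=
  if h : ∃ s : ↥S, s ⊗ₜ[ℂ] t1 = a then h.choose else 0

/-- Extract `t` from an element `1_S ⊗ t` of `ℂ1_S ⊗ T` (and `0` elsewhere). -/
noncomputable def sliceT (s1 : ↥S) (a : ↥S ⊗[ℂ] ↥T) : ↥T :=
  if h : ∃ t : ↥T, s1 ⊗ₜ[ℂ] t = a then h.choose else 0

end SliceExtraction

/-- The relation on the free algebra over `S ⊗ T` encoding the commuting partial product:
`(c•(1⊗1)) · x ~ c•x`, `x · (c•(1⊗1)) ~ c•x`, `(s⊗1)·(1⊗t) ~ s⊗t` and `(1⊗t)·(s⊗1) ~ s⊗t`. -/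
def comRel (s1 : ↥S) (t1 : ↥T) :
    TensorAlgebra ℂ (↥S ⊗[ℂ] ↥T) → TensorAlgebra ℂ (↥S ⊗[ℂ] ↥T) → Prop := fun p q =>
  (∃ (c : ℂ) (x : ↥S ⊗[ℂ] ↥T),
      p = TensorAlgebra.ι ℂ (c • (s1 ⊗ₜ[ℂ] t1)) * TensorAlgebra.ι ℂ x ∧
      q = TensorAlgebra.ι ℂ (c • x)) ∨
  (∃ (c : ℂ) (x : ↥S ⊗[ℂ] ↥T),
      p = TensorAlgebra.ι ℂ x * TensorAlgebra.ι ℂ (c • (s1 ⊗ₜ[ℂ] t1)) ∧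
      q = TensorAlgebra.ι ℂ (c • x)) ∨
  (∃ (s : ↥S) (t : ↥T),
      p = TensorAlgebra.ι ℂ (s ⊗ₜ[ℂ] t1) * TensorAlgebra.ι ℂ (s1 ⊗ₜ[ℂ] t) ∧
      q = TensorAlgebra.ι ℂ (s ⊗ₜ[ℂ] t)) ∨
  (∃ (s : ↥S) (t : ↥T),
      p = TensorAlgebra.ι ℂ (s1 ⊗ₜ[ℂ] t) * TensorAlgebra.ι ℂ (s ⊗ₜ[ℂ] t1) ∧
      q = TensorAlgebra.ι ℂ (s ⊗ₜ[ℂ] t))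

/-- The quotient `F_m(S ⊗ T)` of the free algebra on `S ⊗ T` by the ideal generated by the
commuting-partial-product relations. -/
abbrev ComFreeAlg (s1 : ↥S) (t1 : ↥T) : Type _ := RingQuot (comRel S T s1 t1)

/-- The canonical map `S ⊗ T → F_m(S ⊗ T)`. -/
noncomputable def comEmb (s1 : ↥S) (t1 : ↥T) : (↥S ⊗[ℂ] ↥T) → ComFreeAlg S T s1 t1 :=
  fun v => RingQuot.mkAlgHom ℂ (comRel S T s1 t1) (TensorAlgebra.ι ℂ v)

/-- A permissible factorization datum for the commuting tensor product: a chain of matrices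
over `S ⊗ T` with compatible dimensions, each factor having all entries in `S ⊗ ℂ1_T`
(`sides i = true`) or all entries in `ℂ1_S ⊗ T` (`sides i = false`). -/
structure ComFact (s1 : ↥S) (t1 : ↥T) (n k : ℕ) where
  /-- the number of factors -/
  len : ℕ
  pos : 1 ≤ len
  /-- the sequence of dimensions -/
  dims : Fin (len + 1) → ℕ
  dim_first : dims 0 = n
  dim_last : dims (Fin.last len) = k
  /-- the factors -/
  mats : ∀ i : Fin len, Matrix (Fin (dims i.castSucc)) (Fin (dims i.succ)) (↥S ⊗[ℂ] ↥T)
  /-- which side each factor lies on -/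
  sides : Fin len → Bool
  mem : ∀ (i : Fin len) r c,
    if sides i then mats i r c ∈ leftSlice S T t1 else mats i r c ∈ rightSlice S T s1

/-- The product of the factors of a `ComFact`, computed in a semiring `R` via a map `f`. -/
noncomputable def ComFact.prodIn {s1 : ↥S} {t1 : ↥T} {n k : ℕ}
    (C : ComFact S T s1 t1 n k) {R : Type*} [Semiring R] (f : (↥S ⊗[ℂ] ↥T) → R) :
    Matrix (Fin n) (Fin k) R :=
  Matrix.of fun i j =>
    ∑ p ∈ Finset.univ.filter
        (fun p : (∀ t : Fin (C.len + 1), Fin (C.dims t)) =>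
          p 0 = Fin.cast C.dim_first.symm i ∧ p (Fin.last C.len) = Fin.cast C.dim_last.symm j),
      (List.ofFn fun t : Fin C.len => f (C.mats t (p t.castSucc) (p t.succ))).prod

/-- The cost of a `ComFact`: the product of the norms of its factors, each computed via the
isometric identification of matrices over `S ⊗ ℂ1_T` with matrices over `S ⊆ B(H)`,
respectively of matrices over `ℂ1_S ⊗ T` with matrices over `T ⊆ B(K)`. -/
noncomputable def ComFact.cost {s1 : ↥S} {t1 : ↥T} {n k : ℕ}
    (C : ComFact S T s1 t1 n k) : ℝ :=
  ∏ i : Fin C.len,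
    if C.sides i
    then subMatNorm ((C.mats i).map (sliceS S T t1))
    else subMatNorm ((C.mats i).map (sliceT S T s1))

/-- The factorization norm `‖·‖ᶜ` on matrices over the algebraic tensor product `S ⊗ T`:
the infimum of the costs of all permissible factorizations whose factors are matrices with
all entries in `S ⊗ ℂ1_T` or all entries in `ℂ1_S ⊗ T`. -/
noncomputable def comNorm (s1 : ↥S) (t1 : ↥T) {n k : ℕ}
    (A : Matrix (Fin n) (Fin k) (↥S ⊗[ℂ] ↥T)) : ℝ :=
  sInf { r : ℝ | ∃ C : ComFact S T s1 t1 n k,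
    ComFact.prodIn S T C (comEmb S T s1 t1) = A.map (comEmb S T s1 t1) ∧
    r = ComFact.cost S T C }

section FactorizationSystem

open Matrix
open scoped ComplexOrder

/-- Every contractive scalar matrix stays contractive when applied to vectors of an inner product
space. -/
theorem sum_norm_sq_smul_le {E : Type*} [SeminormedAddCommGroup E] [InnerProductSpace ℂ E]
    {ι κ : Type} [Fintype ι] [Fintype κ] (u : Matrix ι κ ℂ)
    (hu : ∀ v : κ → ℂ, ∑ i, ‖(u *ᵥ v) i‖ ^ 2 ≤ ∑ j, ‖v j‖ ^ 2) (h : κ → E) :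
    ∑ i, ‖∑ j, u i j • h j‖ ^ 2 ≤ ∑ j, ‖h j‖ ^ 2 := by
  classical
  have hpsd : (1 - uᴴ * u).PosSemidef := by
    refine Matrix.PosSemidef.of_dotProduct_mulVec_nonneg ?_ fun v => ?_
    · simp [Matrix.IsHermitian, Matrix.conjTranspose_mul]
    · have h1 : ∀ {ι : Type} [Fintype ι] (w : ι → ℂ),
          star w ⬝ᵥ w = ((∑ i, ‖w i‖ ^ 2 : ℝ) : ℂ) := fun w => by
        simp [dotProduct, Complex.conj_mul']
      have h2 : star v ⬝ᵥ (1 - uᴴ * u) *ᵥ v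
          = ((∑ j, ‖v j‖ ^ 2 - ∑ i, ‖(u *ᵥ v) i‖ ^ 2 : ℝ) : ℂ) := by
        rw [Matrix.sub_mulVec, dotProduct_sub, Matrix.one_mulVec, ← Matrix.mulVec_mulVec,
          Matrix.dotProduct_mulVec, ← Matrix.star_mulVec, h1, h1, Complex.ofReal_sub]
      rw [h2]
      exact_mod_cast sub_nonneg.2 (hu v)
  obtain ⟨m, b, hb⟩ := Matrix.posSemidef_iff_eq_sum_vecMulVec.1 hpsd
  let B : Matrix (Fin m) κ ℂ := Matrix.of fun i => star (b i)
  have hB : 1 - uᴴ * u = Bᴴ * B := by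
    rw [hb]
    ext j k
    simp [B, Matrix.sum_apply, Matrix.mul_apply, Matrix.vecMulVec_apply]
  have key : ∀ (ι' : Type) [Fintype ι'] (w : Matrix ι' κ ℂ),
      ((∑ i, ‖∑ j, w i j • h j‖ ^ 2 : ℝ) : ℂ)
        = ∑ j, ∑ k, (wᴴ * w) j k * inner ℂ (h j) (h k) := by
    intro ι' _ w
    have hn : ∀ v : E, ((‖v‖ ^ 2 : ℝ) : ℂ) = inner ℂ v v := fun v => by
      rw [inner_self_eq_norm_sq_to_K]; simp
    rw [Complex.ofReal_sum]
    simp_rw [hn, sum_inner, inner_sum, inner_smul_left, inner_smul_right, Matrix.mul_apply,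
      Finset.sum_mul, Matrix.conjTranspose_apply]
    rw [Finset.sum_comm]
    refine Finset.sum_congr rfl fun j _ => ?_
    rw [Finset.sum_comm]
    refine Finset.sum_congr rfl fun k _ => Finset.sum_congr rfl fun i _ => ?_
    rw [mul_assoc]; rfl
  have e2 := key _ u
  have e3 := key _ B
  have e4 : ((∑ j, ‖h j‖ ^ 2 : ℝ) : ℂ) = ((∑ i, ‖∑ j, u i j • h j‖ ^ 2 : ℝ) : ℂ)
      + ((∑ i, ‖∑ j, B i j • h j‖ ^ 2 : ℝ) : ℂ) := by
    rw [e2, e3, ← hB, ← Finset.sum_add_distrib]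
    simp_rw [← Finset.sum_add_distrib, ← add_mul, ← Matrix.add_apply, add_sub_cancel]
    simp [Matrix.one_apply]
  have e5 : ∑ j, ‖h j‖ ^ 2 = ∑ i, ‖∑ j, u i j • h j‖ ^ 2 + ∑ i, ‖∑ j, B i j • h j‖ ^ 2 := by
    exact_mod_cast e4
  have : 0 ≤ ∑ i, ‖∑ j, B i j • h j‖ ^ 2 := by positivity
  linarith

/-- Classes of rectangular matrices over an algebra that are closed under products and under
direct sums with identity matrices, and that contain all contractive scalar matrices. -/
structure ContractionSystem (F : Type) [Ring F] [Algebra ℂ F] where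
  /-- membership in the class -/
  mem : ∀ {ι κ : Type} [Fintype ι] [Fintype κ], Matrix ι κ F → Prop
  mul : ∀ {ι κ μ : Type} [Fintype ι] [Fintype κ] [Fintype μ] {a : Matrix ι κ F}
    {b : Matrix κ μ F}, mem a → mem b → mem (a * b)
  diag : ∀ {ι κ γ : Type} [Fintype ι] [Fintype κ] [Fintype γ] [DecidableEq γ]
    {a : Matrix ι κ F}, mem a → mem (fromBlocks a 0 0 (1 : Matrix γ γ F))
  scalar : ∀ {ι κ : Type} [Fintype ι] [Fintype κ] (u : Matrix ι κ ℂ),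
    (∀ v : κ → ℂ, ∑ i, ‖(u *ᵥ v) i‖ ^ 2 ≤ ∑ j, ‖v j‖ ^ 2) → mem (u.map (algebraMap ℂ F))

variable {F : Type} [Ring F] [Algebra ℂ F]

/-- The quadratic function on the dual of the row space attached to the rows of a matrix. -/
def rowQuad {α κ : Type} [Fintype α] (x : Matrix α κ F) (f : Module.Dual ℂ (κ → F)) : ℝ :=
  ∑ i, ‖f (x i)‖ ^ 2

theorem rowQuad_fromRows {α β κ : Type} [Fintype α] [Fintype β] (x : Matrix α κ F)
    (y : Matrix β κ F) (f : Module.Dual ℂ (κ → F)) :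
    rowQuad (fromRows x y) f = rowQuad x f + rowQuad y f := by
  simp only [rowQuad, Fintype.sum_sum_type]; rfl

theorem rowQuad_smul {α κ : Type} [Fintype α] (r : ℝ) (x : Matrix α κ F)
    (f : Module.Dual ℂ (κ → F)) : rowQuad ((r : ℂ) • x) f = r ^ 2 * rowQuad x f := by
  have h : ∀ i, ((r : ℂ) • x) i = (r : ℂ) • x i := fun i => rfl
  simp [rowQuad, Finset.mul_sum, h, mul_pow]

theorem rowQuad_nonneg {α κ : Type} [Fintype α] (x : Matrix α κ F)
    (f : Module.Dual ℂ (κ → F)) : 0 ≤ rowQuad x f := by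
  unfold rowQuad; positivity

/-- Domination of quadratic functions is implemented by a contractive scalar matrix. -/
theorem exists_scalar_of_rowQuad_le {α β κ : Type} [Fintype α] [Fintype β] (x : Matrix α κ F)
    (y : Matrix β κ F) (h : ∀ f, rowQuad x f ≤ rowQuad y f) :
    ∃ u : Matrix α β ℂ, (∀ v : β → ℂ, ∑ i, ‖(u *ᵥ v) i‖ ^ 2 ≤ ∑ j, ‖v j‖ ^ 2) ∧
      x = u.map (algebraMap ℂ F) * y := by
  classical
  let X : Module.Dual ℂ (κ → F) →ₗ[ℂ] EuclideanSpace ℂ α :=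
    (WithLp.linearEquiv 2 ℂ (α → ℂ)).symm.toLinearMap ∘ₗ
      LinearMap.pi fun i => Module.Dual.eval ℂ (κ → F) (x i)
  let Y : Module.Dual ℂ (κ → F) →ₗ[ℂ] EuclideanSpace ℂ β :=
    (WithLp.linearEquiv 2 ℂ (β → ℂ)).symm.toLinearMap ∘ₗ
      LinearMap.pi fun i => Module.Dual.eval ℂ (κ → F) (y i)
  have hX : ∀ f i, X f i = f (x i) := fun f i => rfl
  have hY : ∀ f i, Y f i = f (y i) := fun f i => rfl
  have hXY : ∀ f, ‖X f‖ ≤ ‖Y f‖ := fun f => by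
    rw [EuclideanSpace.norm_eq, EuclideanSpace.norm_eq]
    exact Real.sqrt_le_sqrt (h f)
  obtain ⟨g, hg⟩ := LinearMap.exists_rightInverse_of_surjective Y.rangeRestrict
    (LinearMap.range_rangeRestrict Y)
  have hg' : ∀ w, Y (g w) = w := fun w => congrArg Subtype.val (LinearMap.congr_fun hg w)
  let P := (LinearMap.range Y).orthogonalProjectionOnto
  let U : EuclideanSpace ℂ β →ₗ[ℂ] EuclideanSpace ℂ α := X ∘ₗ g ∘ₗ P.toLinearMap
  have hU : ∀ v, ‖U v‖ ≤ ‖v‖ := fun v => by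
    refine (hXY _).trans ?_
    change ‖Y (g (P v))‖ ≤ ‖v‖
    rw [hg']
    exact Submodule.norm_orthogonalProjectionOnto_apply_le _ v
  have hUY : ∀ f, U (Y f) = X f := fun f => by
    have h1 : P (Y f) = ⟨Y f, LinearMap.mem_range_self Y f⟩ :=
      Submodule.orthogonalProjectionOnto_mem_subspace_eq_self (K := LinearMap.range Y)
        ⟨Y f, LinearMap.mem_range_self Y f⟩
    have h2 : ‖X (g (P (Y f)) - f)‖ ≤ 0 := by
      refine (hXY _).trans ?_
      rw [map_sub, hg', h1]; simp
    have h3 := norm_le_zero_iff.1 h2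
    rw [map_sub, sub_eq_zero] at h3
    exact h3
  have hmul : ∀ v : β → ℂ, (LinearMap.toMatrix (EuclideanSpace.basisFun β ℂ).toBasis
      (EuclideanSpace.basisFun α ℂ).toBasis U) *ᵥ v = (U (WithLp.toLp 2 v)).ofLp := fun v => by
    have := LinearMap.toMatrix_mulVec_repr (EuclideanSpace.basisFun β ℂ).toBasis
      (EuclideanSpace.basisFun α ℂ).toBasis U (WithLp.toLp 2 v)
    exact this
  refine ⟨LinearMap.toMatrix (EuclideanSpace.basisFun β ℂ).toBasis
    (EuclideanSpace.basisFun α ℂ).toBasis U, fun v => ?_, ?_⟩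
  · have := pow_le_pow_left₀ (norm_nonneg _) (hU (WithLp.toLp 2 v)) 2
    rw [EuclideanSpace.norm_sq_eq, EuclideanSpace.norm_sq_eq] at this
    rw [hmul]
    exact this
  · funext i
    rw [← sub_eq_zero, ← Module.forall_dual_apply_eq_zero_iff ℂ]
    intro f
    have h1 : ∀ u : Matrix α β ℂ, (u.map (algebraMap ℂ F) * y) i = ∑ j, u i j • y j := by
      intro u
      funext k
      simp [Matrix.mul_apply, Algebra.smul_def]
    rw [map_sub, h1, map_sum, ← hX, ← hUY, sub_eq_zero]
    have h2 := congrFun (hmul (Y f).ofLp) i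
    simp only [Matrix.mulVec, dotProduct] at h2
    rw [WithLp.toLp_ofLp] at h2
    rw [← h2]
    simp [hY]

namespace ContractionSystem

variable (C : ContractionSystem F)

/-- `C.Dom x y` says that `x` is a contraction of the class `C` applied to `y`. -/
def Dom {α β κ : Type} [Fintype α] [Fintype β] (x : Matrix α κ F) (y : Matrix β κ F) : Prop :=
  ∃ a : Matrix α β F, C.mem a ∧ x = a * y

variable {C}
variable {α β γ δ κ : Type} [Fintype α] [Fintype β] [Fintype γ] [Fintype δ]

theorem Dom.of_rowQuad_le {x : Matrix α κ F} {y : Matrix β κ F}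
    (h : ∀ f, rowQuad x f ≤ rowQuad y f) : C.Dom x y := by
  obtain ⟨u, hu, rfl⟩ := exists_scalar_of_rowQuad_le x y h
  exact ⟨_, C.scalar u hu, rfl⟩

theorem Dom.trans {x : Matrix α κ F} {y : Matrix β κ F} {z : Matrix γ κ F}
    (h1 : C.Dom x y) (h2 : C.Dom y z) : C.Dom x z := by
  obtain ⟨a, ha, rfl⟩ := h1
  obtain ⟨b, hb, rfl⟩ := h2
  exact ⟨a * b, C.mul ha hb, (Matrix.mul_assoc _ _ _).symm⟩

theorem Dom.smul {x : Matrix α κ F} {y : Matrix β κ F} (h : C.Dom x y) (r : ℂ) :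
    C.Dom (r • x) (r • y) := by
  obtain ⟨a, ha, rfl⟩ := h
  exact ⟨a, ha, (Matrix.mul_smul _ _ _).symm⟩

theorem Dom.fromRows_left {x : Matrix α κ F} {y : Matrix β κ F} (h : C.Dom x y)
    (z : Matrix γ κ F) : C.Dom (fromRows x z) (fromRows y z) := by
  classical
  obtain ⟨a, ha, rfl⟩ := h
  refine ⟨fromBlocks a 0 0 1, C.diag ha, ?_⟩
  rw [fromBlocks_mul_fromRows]
  simp

theorem Dom.fromRows {x : Matrix α κ F} {y : Matrix β κ F} {z : Matrix γ κ F}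
    {w : Matrix δ κ F} (h : C.Dom x y) (h' : C.Dom z w) :
    C.Dom (fromRows x z) (fromRows y w) := by
  have swap : C.Dom (Matrix.fromRows y z) (Matrix.fromRows z y) :=
    of_rowQuad_le fun f => by rw [rowQuad_fromRows, rowQuad_fromRows, add_comm]
  have swap' : C.Dom (Matrix.fromRows w y) (Matrix.fromRows y w) :=
    of_rowQuad_le fun f => by rw [rowQuad_fromRows, rowQuad_fromRows, add_comm]
  exact (h.fromRows_left z).trans (swap.trans ((h'.fromRows_left y).trans swap'))

/-- A domination inequality with a common summand can be iterated. -/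
theorem Dom.iterate {x : Matrix α κ F} {y : Matrix β κ F} {z : Matrix γ κ F}
    {w : Matrix δ κ F} (h : C.Dom y x)
    (hq : ∀ f, rowQuad x f + rowQuad z f ≤ rowQuad y f + rowQuad w f) (k : ℕ) :
    C.Dom (Matrix.fromRows x (((√k : ℝ) : ℂ) • z)) (Matrix.fromRows x (((√k : ℝ) : ℂ) • w)) := by
  have base : C.Dom (Matrix.fromRows x z) (Matrix.fromRows x w) :=
    (of_rowQuad_le (y := Matrix.fromRows y w) fun f => by
      rw [rowQuad_fromRows, rowQuad_fromRows]; exact hq f).trans (h.fromRows_left w)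
  have sq : ∀ n : ℕ, (√(n : ℝ)) ^ 2 = n := fun n => Real.sq_sqrt (Nat.cast_nonneg n)
  induction k with
  | zero =>
    refine of_rowQuad_le fun f => ?_
    simp only [rowQuad_fromRows, rowQuad_smul, sq]
    simp
  | succ k ih =>
    have h1 : C.Dom (Matrix.fromRows x (((√(k + 1 : ℕ) : ℝ) : ℂ) • z))
        (Matrix.fromRows (Matrix.fromRows x (((√k : ℝ) : ℂ) • z)) z) :=
      of_rowQuad_le fun f => by
        simp only [rowQuad_fromRows, rowQuad_smul, sq]; push_cast; linarith
    have h2 : C.Dom (Matrix.fromRows (Matrix.fromRows x (((√k : ℝ) : ℂ) • w)) z)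
        (Matrix.fromRows (Matrix.fromRows x z) (((√k : ℝ) : ℂ) • w)) :=
      of_rowQuad_le fun f => by simp only [rowQuad_fromRows]; linarith
    have h3 : C.Dom (Matrix.fromRows (Matrix.fromRows x w) (((√k : ℝ) : ℂ) • w))
        (Matrix.fromRows x (((√(k + 1 : ℕ) : ℝ) : ℂ) • w)) :=
      of_rowQuad_le fun f => by
        simp only [rowQuad_fromRows, rowQuad_smul, sq]; push_cast; linarith
    exact h1.trans ((ih.fromRows_left z).trans (h2.trans ((base.fromRows_left _).trans h3)))

theorem Dom.of_smul_le {x : Matrix α κ F} {r s : ℝ} (h : r ^ 2 ≤ s ^ 2) :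
    C.Dom ((r : ℂ) • x) ((s : ℂ) • x) :=
  of_rowQuad_le fun f => by
    rw [rowQuad_smul, rowQuad_smul]
    exact mul_le_mul_of_nonneg_right h (rowQuad_nonneg _ _)

theorem Dom.real_smul {x : Matrix α κ F} {y : Matrix β κ F} {r s : ℝ}
    (h : C.Dom x ((s : ℂ) • y)) : C.Dom ((r : ℂ) • x) (((r * s : ℝ) : ℂ) • y) := by
  rw [Complex.ofReal_mul, mul_smul]
  exact h.smul _

/-- If `A` is not dominated by small multiples of the identity, then no sum of a gain along a
contraction with a positive multiple of the identity can be compensated by `A`. -/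
theorem Dom.not_rowQuad_le {κ : Type} [Fintype κ] [DecidableEq κ]
    {x : Matrix α κ F} {y : Matrix β κ F} {A : Matrix γ κ F} {c l t R X : ℝ}
    (hc0 : 0 < c) (hc : ∀ r : ℝ, 0 ≤ r → C.Dom A ((r : ℂ) • (1 : Matrix κ κ F)) → c ≤ r)
    (hA : C.Dom A ((R : ℂ) • (1 : Matrix κ κ F))) (hx : C.Dom x ((X : ℂ) • (1 : Matrix κ κ F)))
    (hyx : C.Dom y x) (hl : 0 ≤ l) (ht : 0 < t)
    (hq : ∀ f, rowQuad x f + l * rowQuad A f + t * rowQuad (1 : Matrix κ κ F) f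
      ≤ rowQuad y f + l * c ^ 2 * rowQuad (1 : Matrix κ κ F) f) : False := by
  set ρ : ℝ := |R| + 1 with hρ
  have hρ0 : 0 < ρ := by positivity
  have hA' : C.Dom A ((ρ : ℂ) • (1 : Matrix κ κ F)) := by
    refine hA.trans (of_smul_le ?_)
    rw [← sq_abs R]
    exact pow_le_pow_left₀ (abs_nonneg R) (by linarith) 2
  set m : ℝ := l + t / ρ ^ 2 with hm
  have hm0 : 0 < m := by positivity
  let z : Matrix (γ ⊕ κ) κ F :=
    Matrix.fromRows ((√l : ℂ) • A) ((√t : ℂ) • (1 : Matrix κ κ F))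
  let w : Matrix κ κ F := ((√l * c : ℝ) : ℂ) • (1 : Matrix κ κ F)
  have hz : C.Dom ((√m : ℂ) • A) z := by
    have h1 : C.Dom (((√t / ρ : ℝ) : ℂ) • A) ((√t : ℂ) • (1 : Matrix κ κ F)) := by
      have := hA'.real_smul (r := √t / ρ)
      rwa [div_mul_cancel₀ _ hρ0.ne'] at this
    refine Dom.trans (y := Matrix.fromRows ((√l : ℂ) • A) (((√t / ρ : ℝ) : ℂ) • A))
      (of_rowQuad_le fun f => ?_) (Dom.fromRows (of_rowQuad_le fun f => le_rfl) h1)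
    rw [rowQuad_fromRows, rowQuad_smul, rowQuad_smul, rowQuad_smul, div_pow, Real.sq_sqrt hm0.le,
      Real.sq_sqrt hl, Real.sq_sqrt ht.le, hm, add_mul]
  have hbound : ∀ k : ℕ, 0 < k → c ^ 2 * (k * m) ≤ X ^ 2 + k * (l * c ^ 2) := by
    intro k hk
    have hk' : (0 : ℝ) < k := Nat.cast_pos.2 hk
    have hit := Dom.iterate (z := z) (w := w) hyx (fun f => by
      simp only [z, w, rowQuad_fromRows, rowQuad_smul, mul_pow, Real.sq_sqrt hl,
        Real.sq_sqrt ht.le]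
      linarith [hq f]) k
    have hlow : C.Dom (((√k : ℝ) : ℂ) • ((√m : ℂ) • A))
        (Matrix.fromRows x (((√k : ℝ) : ℂ) • z)) :=
      (hz.smul _).trans (of_rowQuad_le fun f => by
        rw [rowQuad_fromRows]
        exact le_add_of_nonneg_left (rowQuad_nonneg _ _))
    set q : ℝ := X ^ 2 + k * (l * c ^ 2) with hqdef
    have hq0 : 0 ≤ q := by positivity
    have hup : C.Dom (Matrix.fromRows x (((√k : ℝ) : ℂ) • w))
        ((√q : ℂ) • (1 : Matrix κ κ F)) := by
      refine (Dom.fromRows_left hx _).trans (of_rowQuad_le fun f => ?_)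
      simp only [w, rowQuad_fromRows, rowQuad_smul, mul_pow, Real.sq_sqrt hl, Real.sq_sqrt hq0,
        Real.sq_sqrt hk'.le]
      rw [hqdef]
      linarith
    have hfin := ((hlow.trans hit).trans hup).real_smul (r := (√k * √m)⁻¹)
    have hs : (0 : ℝ) < √k * √m := mul_pos (Real.sqrt_pos.2 hk') (Real.sqrt_pos.2 hm0)
    rw [smul_smul, smul_smul, ← Complex.ofReal_mul, ← Complex.ofReal_mul, mul_assoc,
      inv_mul_cancel₀ hs.ne', Complex.ofReal_one, one_smul] at hfin
    have := hc _ (by positivity) hfin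
    rw [inv_mul_eq_div, le_div_iff₀ hs] at this
    have h2 := pow_le_pow_left₀ (by positivity) this 2
    rwa [mul_pow, mul_pow, Real.sq_sqrt hk'.le, Real.sq_sqrt hm0.le, Real.sq_sqrt hq0] at h2
  set ε : ℝ := c ^ 2 * (t / ρ ^ 2) with hε
  have hε0 : 0 < ε := by positivity
  obtain ⟨k, hk⟩ := exists_nat_gt (X ^ 2 / ε)
  have hk0 : (0 : ℝ) < k := lt_of_le_of_lt (by positivity) hk
  have h1 := hbound k (by exact_mod_cast hk0)
  rw [div_lt_iff₀ hε0] at hk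
  have h2 : c ^ 2 * (k * m) = k * (l * c ^ 2) + k * ε := by rw [hm, hε]; ring
  linarith

/-- The Hahn-Banach step: there is a positive functional on quadratic functions that is
decreasing along contractions, normalized at the identity, and large at `A`. -/
theorem exists_functional {κ : Type} [Fintype κ] [DecidableEq κ]
    (hb : ∀ {ι : Type} [Fintype ι] (a : Matrix ι κ F),
      ∃ R : ℝ, C.Dom a ((R : ℂ) • (1 : Matrix κ κ F)))
    (A : Matrix γ κ F) {c : ℝ} (hc0 : 0 < c)
    (hc : ∀ r : ℝ, 0 ≤ r → C.Dom A ((r : ℂ) • (1 : Matrix κ κ F)) → c ≤ r) :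
    ∃ p : (Module.Dual ℂ (κ → F) → ℝ) →ₗ[ℝ] ℝ,
      (∀ {α β : Type} [Fintype α] [Fintype β] (x : Matrix α κ F) (y : Matrix β κ F),
        C.Dom y x → p (rowQuad y) ≤ p (rowQuad x)) ∧
      p (rowQuad (1 : Matrix κ κ F)) = 1 ∧ c ^ 2 ≤ p (rowQuad A) := by
  let G : Set (Module.Dual ℂ (κ → F) → ℝ) := Set.range fun m => fun f => ‖f m‖ ^ 2
  let E : Submodule ℝ (Module.Dual ℂ (κ → F) → ℝ) := Submodule.span ℝ G
  have hmemE : ∀ {α : Type} [Fintype α] (x : Matrix α κ F), rowQuad x ∈ E := fun x => by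
    have : rowQuad x = ∑ i, fun f : Module.Dual ℂ (κ → F) => ‖f (x i)‖ ^ 2 := by
      funext f; simp [rowQuad]
    rw [this]
    exact Submodule.sum_mem _ fun i _ => Submodule.subset_span ⟨x i, rfl⟩
  let I : Matrix κ κ F := 1
  let P : (Module.Dual ℂ (κ → F) → ℝ) → Prop := fun v =>
    ∃ (α β : Type) (_ : Fintype α) (_ : Fintype β) (x : Matrix α κ F) (y : Matrix β κ F) (l : ℝ),
      C.Dom y x ∧ 0 ≤ l ∧
        ∀ f, rowQuad x f - rowQuad y f + l * (rowQuad A f - c ^ 2 * rowQuad I f) ≤ v f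
  have Padd : ∀ {v w}, P v → P w → P (v + w) := by
    rintro v w ⟨α, β, _, _, x, y, l, h, hl, hv⟩ ⟨α', β', _, _, x', y', l', h', hl', hw⟩
    refine ⟨α ⊕ α', β ⊕ β', inferInstance, inferInstance, Matrix.fromRows x x',
      Matrix.fromRows y y', l + l', h.fromRows h', add_nonneg hl hl', fun f => ?_⟩
    rw [rowQuad_fromRows, rowQuad_fromRows, Pi.add_apply]
    linarith [hv f, hw f]
  have Psmul : ∀ {v} (r : ℝ), 0 ≤ r → P v → P (r • v) := by
    rintro v r hr ⟨α, β, _, _, x, y, l, h, hl, hv⟩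
    refine ⟨α, β, inferInstance, inferInstance, (√r : ℂ) • x, (√r : ℂ) • y, r * l, h.smul _,
      mul_nonneg hr hl, fun f => ?_⟩
    rw [rowQuad_smul, rowQuad_smul, Real.sq_sqrt hr, Pi.smul_apply, smul_eq_mul]
    have := mul_le_mul_of_nonneg_left (hv f) hr
    linarith
  have Pdom : ∀ {α β : Type} [Fintype α] [Fintype β] (x : Matrix α κ F) (y : Matrix β κ F),
      C.Dom y x → P (rowQuad x - rowQuad y) := fun {α β _ _} x y h =>
    ⟨α, β, inferInstance, inferInstance, x, y, 0, h, le_rfl, fun f => by simp⟩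
  have Pnonneg : ∀ {v}, (∀ f, 0 ≤ v f) → P v := fun {v} h =>
    ⟨κ, κ, inferInstance, inferInstance, I, I, 0, Dom.of_rowQuad_le fun _ => le_rfl, le_rfl,
      fun f => by simpa using h f⟩
  have PA : P (rowQuad A - c ^ 2 • rowQuad I) :=
    ⟨κ, κ, inferInstance, inferInstance, I, I, 1, Dom.of_rowQuad_le fun _ => le_rfl, zero_le_one,
      fun f => by simp⟩
  have Pneg : ∀ t : ℝ, P (t • rowQuad I) → 0 ≤ t := by
    rintro t ⟨α, β, _, _, x, y, l, h, hl, hv⟩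
    by_contra! ht
    obtain ⟨R, hR⟩ := hb A
    obtain ⟨X, hX⟩ := hb x
    refine Dom.not_rowQuad_le hc0 hc hR hX h hl (neg_pos.2 ht) fun f => ?_
    have := hv f
    rw [Pi.smul_apply, smul_eq_mul] at this
    linarith
  let s : PointedCone ℝ E :=
    { carrier := {v | P v}
      add_mem' := fun {v w} hv hw => Padd hv hw
      zero_mem' := Pnonneg fun f => le_rfl
      smul_mem' := fun r v hv => Psmul r.1 r.2 hv }
  let e : E := ⟨rowQuad I, hmemE I⟩
  have he : e ≠ 0 := fun h0 => by
    have h1 : rowQuad I = 0 := congrArg Subtype.val h0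
    have h2 : P ((-1 : ℝ) • rowQuad I) := by
      rw [h1]; exact Pnonneg fun f => by simp
    linarith [Pneg _ h2]
  obtain ⟨g, hg1, hg2⟩ := riesz_extension s (LinearPMap.mkSpanSingleton e (1 : ℝ) he)
    (by
      rintro ⟨v, hv⟩ hvs
      obtain ⟨t, rfl⟩ := Submodule.mem_span_singleton.1 hv
      have h0 := Pneg t hvs
      have h1 := LinearPMap.mkSpanSingleton'_apply e (1 : ℝ) (fun c hc => by
        rw [(smul_eq_zero.1 hc).resolve_right he, map_zero, zero_smul]) t hv
      exact (h0.trans_eq (mul_one t).symm).trans_eq h1.symm)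
    (by
      have key : ∀ v : E, ∃ t : ℝ, P (t • rowQuad I + v) ∧ P (t • rowQuad I - v) := by
        rintro ⟨v, hv⟩
        induction hv using Submodule.span_induction with
        | mem v hv =>
          obtain ⟨m, rfl⟩ := hv
          let x : Matrix Unit κ F := Matrix.of fun _ => m
          have hx : rowQuad x = fun f : Module.Dual ℂ (κ → F) => ‖f m‖ ^ 2 := by
            funext f
            simp only [rowQuad, Finset.univ_unique, Finset.sum_singleton]
            rfl
          obtain ⟨R, hR⟩ := hb x
          refine ⟨R ^ 2, Pnonneg fun f => ?_, ?_⟩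
          · have := rowQuad_nonneg I f
            simp only [Pi.add_apply, Pi.smul_apply, smul_eq_mul]
            positivity
          · have := Pdom _ _ hR
            rw [hx] at this
            convert this using 1
            funext f
            exact congrArg (· - ‖f m‖ ^ 2) (rowQuad_smul R (1 : Matrix κ κ F) f).symm
        | zero => exact ⟨0, Pnonneg fun f => by simp, Pnonneg fun f => by simp⟩
        | add v w _ _ h1 h2 =>
          obtain ⟨t, h1, h1'⟩ := h1
          obtain ⟨t', h2, h2'⟩ := h2
          refine ⟨t + t', ?_, ?_⟩
          · convert Padd h1 h2 using 1; simp only [add_smul]; abel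
          · convert Padd h1' h2' using 1; simp only [add_smul]; abel
        | smul r v _ h =>
          obtain ⟨t, h1, h1'⟩ := h
          rcases le_total 0 r with hr | hr
          · refine ⟨r * t, ?_, ?_⟩
            · convert Psmul r hr h1 using 1; simp [mul_smul]
            · convert Psmul r hr h1' using 1; simp [mul_smul, smul_sub]
          · refine ⟨-r * t, ?_, ?_⟩
            · convert Psmul (-r) (by linarith) h1' using 1; simp [mul_smul, smul_sub]
            · convert Psmul (-r) (by linarith) h1 using 1; simp [mul_smul]; abel
      intro v
      obtain ⟨t, ht, -⟩ := key v
      exact ⟨⟨t • e, Submodule.smul_mem _ _ (Submodule.mem_span_singleton_self e)⟩, ht⟩)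
  obtain ⟨p, hp⟩ := g.exists_extend
  have hpE : ∀ v (hv : v ∈ E), p v = g ⟨v, hv⟩ := fun v hv => LinearMap.congr_fun hp ⟨v, hv⟩
  have hpos : ∀ v, v ∈ E → P v → 0 ≤ p v := fun v hv hPv => by
    rw [hpE v hv]; exact hg2 _ hPv
  have hI : p (rowQuad I) = 1 := by
    rw [hpE _ (hmemE I)]
    have := hg1 ⟨e, Submodule.mem_span_singleton_self e⟩
    rw [this]
    exact LinearPMap.mkSpanSingleton_apply _ _ he 1
  refine ⟨p, fun x y h => ?_, hI, ?_⟩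
  · have := hpos _ (E.sub_mem (hmemE x) (hmemE y)) (Pdom x y h)
    rw [map_sub] at this
    linarith
  · have := hpos _ (E.sub_mem (hmemE A) (E.smul_mem _ (hmemE I))) PA
    rw [map_sub, map_smul, hI, smul_eq_mul] at this
    linarith

/-- A left module over an algebra with a pre-inner product for which the action is bounded
completes to a representation on a Hilbert space. -/
theorem exists_algHom_completion {M : Type} [AddCommGroup M] [Module ℂ M] [Module F M]
    [IsScalarTower ℂ F M] (core : PreInnerProductSpace.Core ℂ M)
    (hb : ∀ b : F, ∃ R : ℝ, ∀ m : M,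
      (core.inner (b • m) (b • m)).re ≤ R ^ 2 * (core.inner m m).re) :
    ∃ (L : Type) (_ : NormedAddCommGroup L) (_ : InnerProductSpace ℂ L) (_ : CompleteSpace L)
      (j : M →ₗ[ℂ] L) (π : F →ₐ[ℂ] (L →L[ℂ] L)), DenseRange j ∧
        (∀ m, ‖j m‖ ^ 2 = (core.inner m m).re) ∧ ∀ b m, π b (j m) = j (b • m) := by
  let _ : SeminormedAddCommGroup M :=
    @InnerProductSpace.Core.toSeminormedAddCommGroup ℂ M _ _ _ core
  let _ : InnerProductSpace ℂ M := InnerProductSpace.ofCore core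
  have hn : ∀ m : M, ‖m‖ ^ 2 = (core.inner m m).re := fun m =>
    InnerProductSpace.norm_sq_eq_re_inner (𝕜 := ℂ) m
  have hb' : ∀ b : F, ∃ R : ℝ, ∀ m : M, ‖b • m‖ ≤ R * ‖m‖ := fun b => by
    obtain ⟨R, hR⟩ := hb b
    refine ⟨|R|, fun m => abs_le_of_sq_le_sq' ?_ (by positivity) |>.2⟩
    rw [mul_pow, sq_abs, hn, hn]
    exact hR m
  choose R hR using hb'
  have comm : SMulCommClass F ℂ M := IsScalarTower.to_smulCommClass'
  let act : F → M →L[ℂ] M := fun b =>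
    LinearMap.mkContinuous
      { toFun := fun m => b • m
        map_add' := fun x y => smul_add b x y
        map_smul' := fun c x => smul_comm b c x } (R b) (hR b)
  have hact : ∀ b m, act b m = b • m := fun b m => rfl
  let j : M →L[ℂ] UniformSpace.Completion M := UniformSpace.Completion.toComplL
  have hj : ∀ m, j m = (m : UniformSpace.Completion M) := fun m => rfl
  have hdense : DenseRange j := UniformSpace.Completion.denseRange_coe
  have hext : ∀ f g : UniformSpace.Completion M →L[ℂ] UniformSpace.Completion M,
      (∀ m, f (j m) = g (j m)) → f = g := fun f g h =>
    ContinuousLinearMap.ext fun x => congrFun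
      (hdense.equalizer f.continuous g.continuous (funext h)) x
  have hc : ∀ b m, (act b).completion (j m) = j (b • m) := fun b m =>
    ContinuousLinearMap.completion_apply_coe _ _
  refine ⟨UniformSpace.Completion M, inferInstance, inferInstance, inferInstance, j,
    AlgHom.ofLinearMap
      { toFun := fun b => (act b).completion
        map_add' := fun a b => hext _ _ fun m => by
          rw [_root_.add_apply, hc, hc, hc, add_smul, map_add]
        map_smul' := fun c b => hext _ _ fun m => by
          rw [_root_.smul_apply, hc, hc, smul_assoc, map_smul]; rfl }
      (hext _ _ fun m => ?_) (fun a b => hext _ _ fun m => ?_), hdense, fun m => ?_,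
      fun b m => hc b m⟩
  · exact (hc 1 m).trans (by rw [one_smul]; rfl)
  · rw [mul_apply_eq_comp]
    change (act (a * b)).completion (j m) = (act a).completion ((act b).completion (j m))
    rw [hc, hc, hc, mul_smul]
  · rw [← hn]
    exact congrArg (· ^ 2) (UniformSpace.Completion.norm_coe m)

/-- The pre-inner product defined by a functional on real functions on the dual space. -/
@[reducible] def coreOfFunctional {M : Type} [AddCommGroup M] [Module ℂ M]
    (p : (Module.Dual ℂ M → ℝ) →ₗ[ℝ] ℝ) (hp : ∀ m : M, 0 ≤ p fun f => ‖f m‖ ^ 2) :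
    PreInnerProductSpace.Core ℂ M where
  inner x y := p (fun f => (star (f x) * f y).re) + p (fun f => (star (f x) * f y).im) * Complex.I
  conj_inner_symm x y := by
    have h1 : (fun f : Module.Dual ℂ M => (star (f y) * f x).re)
        = fun f => (star (f x) * f y).re := by
      funext f; simp; ring
    have h2 : (fun f : Module.Dual ℂ M => (star (f y) * f x).im)
        = -fun f => (star (f x) * f y).im := by
      funext f; simp; ring
    rw [h1, h2, map_neg]
    apply Complex.ext <;> simp
  re_inner_nonneg x := by
    have h1 : (fun f : Module.Dual ℂ M => (star (f x) * f x).re) = fun f => ‖f x‖ ^ 2 := by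
      funext f; simp [Complex.sq_norm, Complex.normSq_apply]
    rw [h1]
    simpa using hp x
  add_left x y z := by
    have h1 : (fun f : Module.Dual ℂ M => (star (f (x + y)) * f z).re)
        = (fun f => (star (f x) * f z).re) + fun f => (star (f y) * f z).re := by
      funext f; simp; ring
    have h2 : (fun f : Module.Dual ℂ M => (star (f (x + y)) * f z).im)
        = (fun f => (star (f x) * f z).im) + fun f => (star (f y) * f z).im := by
      funext f; simp; ring
    rw [h1, h2, map_add, map_add]
    push_cast
    ring
  smul_left x y r := by
    have h1 : (fun f : Module.Dual ℂ M => (star (f (r • x)) * f y).re)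
        = r.re • (fun f => (star (f x) * f y).re) + r.im • fun f => (star (f x) * f y).im := by
      funext f; simp; ring
    have h2 : (fun f : Module.Dual ℂ M => (star (f (r • x)) * f y).im)
        = r.re • (fun f => (star (f x) * f y).im) - r.im • fun f => (star (f x) * f y).re := by
      funext f; simp; ring
    rw [h1, h2, map_add, map_sub, map_smul, map_smul, map_smul, map_smul]
    apply Complex.ext
    · simp
    · simp; ring

theorem coreOfFunctional_inner_self {M : Type} [AddCommGroup M] [Module ℂ M]
    (p : (Module.Dual ℂ M → ℝ) →ₗ[ℝ] ℝ) (hp : ∀ m : M, 0 ≤ p fun f => ‖f m‖ ^ 2) (m : M) :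
    ((coreOfFunctional p hp).inner m m).re = p fun f => ‖f m‖ ^ 2 := by
  have h1 : (fun f : Module.Dual ℂ M => (star (f m) * f m).re) = fun f => ‖f m‖ ^ 2 := by
    funext f; simp [Complex.sq_norm, Complex.normSq_apply]
  rw [← h1]
  change (((p _ : ℝ) : ℂ) + ((p _ : ℝ) : ℂ) * Complex.I).re = _
  simp

/-- For a matrix that is not dominated by small multiples of the identity there is a
representation that contracts the whole class and is large at the given matrix. -/
theorem exists_rep {κ : Type} [Fintype κ] [DecidableEq κ]
    (hb : ∀ {ι : Type} [Fintype ι] (a : Matrix ι κ F),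
      ∃ R : ℝ, C.Dom a ((R : ℂ) • (1 : Matrix κ κ F)))
    (hb1 : ∀ b : F, ∃ R : ℝ,
      C.Dom (Matrix.of fun _ _ : Unit => b) ((R : ℂ) • (1 : Matrix Unit Unit F)))
    (A : Matrix γ κ F) {c : ℝ} (hc0 : 0 < c)
    (hc : ∀ r : ℝ, 0 ≤ r → C.Dom A ((r : ℂ) • (1 : Matrix κ κ F)) → c ≤ r) :
    ∃ (L : Type) (_ : NormedAddCommGroup L) (_ : InnerProductSpace ℂ L) (_ : CompleteSpace L)
      (π : F →ₐ[ℂ] (L →L[ℂ] L)),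
      (∀ {ι μ : Type} [Fintype ι] [Fintype μ] (a : Matrix ι μ F), C.mem a → ∀ x : μ → L,
        ∑ i, ‖∑ j, π (a i j) (x j)‖ ^ 2 ≤ ∑ j, ‖x j‖ ^ 2) ∧
      ∃ ξ : κ → L, ∑ j, ‖ξ j‖ ^ 2 = 1 ∧ c ^ 2 ≤ ∑ i, ‖∑ j, π (A i j) (ξ j)‖ ^ 2 := by
  obtain ⟨p, hp, hp1, hpA⟩ := exists_functional hb A hc0 hc
  have hquad : ∀ {α : Type} [Fintype α] (x : Matrix α κ F),
      p (rowQuad x) = ∑ i, p fun f => ‖f (x i)‖ ^ 2 := fun x => by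
    rw [← map_sum]
    congr 1
    funext f
    simp [rowQuad]
  have hp0 : ∀ m : κ → F, 0 ≤ p fun f => ‖f m‖ ^ 2 := fun m => by
    have := hp (Matrix.of fun _ : Unit => m) (Matrix.of (Empty.elim : Empty → κ → F))
      (Dom.of_rowQuad_le fun f => by
        rw [rowQuad, Fintype.sum_empty]; exact rowQuad_nonneg _ _)
    rw [hquad, hquad, Fintype.sum_empty, Fintype.sum_unique] at this
    exact this
  have hrow : ∀ {ι μ : Type} [Fintype μ] (a : Matrix ι μ F) (x : μ → κ → F) (i : ι),
      ∑ j, a i j • x j = (a * Matrix.of x) i := fun a x i => by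
    funext k
    simp [Matrix.mul_apply]
  have hone : Matrix.of (fun k : κ => (Pi.single k 1 : κ → F)) = 1 := by
    ext k l
    simp [Matrix.one_apply, Pi.single_apply, eq_comm]
  have hcontr : ∀ {ι μ : Type} [Fintype ι] [Fintype μ] (a : Matrix ι μ F), C.mem a →
      ∀ x : μ → κ → F, ∑ i, p (fun f => ‖f (∑ j, a i j • x j)‖ ^ 2)
        ≤ ∑ j, p (fun f => ‖f (x j)‖ ^ 2) := by
    intro ι μ _ _ a ha x
    have := hp (Matrix.of x) (a * Matrix.of x) ⟨a, ha, rfl⟩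
    rw [hquad, hquad] at this
    simp only [hrow]
    exact this
  obtain ⟨L, i1, i2, i3, j, π, hd, hn, hπ⟩ :=
    exists_algHom_completion (F := F) (coreOfFunctional p hp0) fun b => by
      obtain ⟨R, a, ha, hab⟩ := hb1 b
      refine ⟨R, fun m => ?_⟩
      have hba : b = (R : ℂ) • a () () := by simpa using congrFun (congrFun hab ()) ()
      have := hcontr a ha fun _ => m
      simp only [Finset.univ_unique, Finset.sum_singleton] at this
      rw [coreOfFunctional_inner_self, coreOfFunctional_inner_self]
      have h2 : (fun f : Module.Dual ℂ (κ → F) => ‖f (b • m)‖ ^ 2)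
          = R ^ 2 • fun f => ‖f (a () () • m)‖ ^ 2 := by
        funext f
        rw [hba, smul_assoc, map_smul]
        simp [mul_pow]
      rw [h2, map_smul, smul_eq_mul]
      exact mul_le_mul_of_nonneg_left this (sq_nonneg R)
  simp_rw [coreOfFunctional_inner_self] at hn
  refine ⟨L, i1, i2, i3, π, fun {ι μ _ _} a ha x => ?_, fun k => j (Pi.single k 1), ?_, ?_⟩
  · have hd' : DenseRange fun (y : μ → κ → F) k => j (y k) := DenseRange.piMap fun _ => hd
    refine hd'.induction_on (p := fun x : μ → L =>
      ∑ i, ‖∑ j, π (a i j) (x j)‖ ^ 2 ≤ ∑ j, ‖x j‖ ^ 2) x ?_ fun y => ?_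
    · exact isClosed_le (by fun_prop) (by fun_prop)
    · simp_rw [hπ, ← map_sum, hn]
      exact hcontr a ha y
  · simp_rw [hn]
    rw [← hp1, hquad]
    exact Finset.sum_congr rfl fun k _ => by rw [← hone]; rfl
  · simp_rw [hπ, ← map_sum, hn, hrow, hone, Matrix.mul_one]
    rwa [hquad] at hpA
theorem hasSum_norm_sq_lp {I : Type} {L : I → Type} [∀ i, NormedAddCommGroup (L i)]
    (x : lp L 2) : HasSum (fun i => ‖x i‖ ^ 2) (‖x‖ ^ 2) := by
  have := lp.hasSum_norm (p := 2) (by norm_num) x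
  simpa using this

/-- The direct sum of a uniformly bounded family of representations. -/
theorem exists_algHom_directSum {I : Type} (L : I → Type) [∀ i, NormedAddCommGroup (L i)]
    [∀ i, InnerProductSpace ℂ (L i)] (π : ∀ i, F →ₐ[ℂ] (L i →L[ℂ] L i))
    (hb : ∀ b : F, ∃ R : ℝ, 0 ≤ R ∧ ∀ i x, ‖π i b x‖ ≤ R * ‖x‖) :
    ∃ ρ : F →ₐ[ℂ] (lp L 2 →L[ℂ] lp L 2), ∀ b (x : lp L 2) i, ρ b x i = π i b (x i) := by
  choose R hR0 hR using hb
  have hR2 : ∀ b i (x : L i), ‖π i b x‖ ^ 2 ≤ R b ^ 2 * ‖x‖ ^ 2 := fun b i x => by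
    rw [← mul_pow]
    exact pow_le_pow_left₀ (norm_nonneg _) (hR b i x) 2
  have hmem : ∀ b (x : lp L 2), Memℓp (fun i => π i b (x i)) 2 := fun b x => by
    refine memℓp_gen ?_
    have := Summable.of_nonneg_of_le (fun i => by positivity) (fun i => hR2 b i (x i))
      ((hasSum_norm_sq_lp x).summable.mul_left (R b ^ 2))
    simpa using this
  let lin : F → lp L 2 →ₗ[ℂ] lp L 2 := fun b =>
    { toFun := fun x => ⟨fun i => π i b (x i), hmem b x⟩
      map_add' := fun x y => lp.ext (funext fun i => map_add (π i b) (x i) (y i))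
      map_smul' := fun c x => lp.ext (funext fun i => map_smul (π i b) c (x i)) }
  have hlin : ∀ b (x : lp L 2) i, lin b x i = π i b (x i) := fun b x i => rfl
  have hbound : ∀ b (x : lp L 2), ‖lin b x‖ ≤ R b * ‖x‖ := fun b x => by
    refine (abs_le_of_sq_le_sq' ?_ (mul_nonneg (hR0 b) (norm_nonneg _))).2
    rw [mul_pow]
    refine hasSum_le (fun i => ?_) (hasSum_norm_sq_lp (lin b x))
      ((hasSum_norm_sq_lp x).mul_left (R b ^ 2))
    rw [hlin]
    exact hR2 b i (x i)
  let op : F → lp L 2 →L[ℂ] lp L 2 := fun b => (lin b).mkContinuous (R b) (hbound b)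
  have hop : ∀ b (x : lp L 2) i, op b x i = π i b (x i) := fun b x i => rfl
  refine ⟨AlgHom.ofLinearMap
    { toFun := op
      map_add' := fun a b => by ext x i; simp [hop]
      map_smul' := fun c b => by ext x i; simp [hop] } (by ext x i; simp [hop])
      (fun a b => by ext x i; simp [hop]), fun b x i => hop b x i⟩

/-- A contraction system has a representation that contracts its members and that detects
all matrices not dominated by small multiples of the identity. -/
theorem exists_universal_rep (C : ContractionSystem F)
    (hb : ∀ {ι κ : Type} [Fintype ι] [Fintype κ] [DecidableEq κ] (a : Matrix ι κ F),
      ∃ R : ℝ, C.Dom a ((R : ℂ) • (1 : Matrix κ κ F))) :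
    ∃ (L : Type) (_ : NormedAddCommGroup L) (_ : InnerProductSpace ℂ L) (_ : CompleteSpace L)
      (π : F →ₐ[ℂ] (L →L[ℂ] L)),
      (∀ {ι μ : Type} [Fintype ι] [Fintype μ] (a : Matrix ι μ F), C.mem a → ∀ x : μ → L,
        ∑ i, ‖∑ j, π (a i j) (x j)‖ ^ 2 ≤ ∑ j, ‖x j‖ ^ 2) ∧
      ∀ (n : ℕ) (A : Matrix (Fin n) (Fin n) F) (c : ℝ), 0 < c →
        (∀ r : ℝ, 0 ≤ r → C.Dom A ((r : ℂ) • (1 : Matrix (Fin n) (Fin n) F)) → c ≤ r) →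
        ∃ ξ : Fin n → L, ∑ j, ‖ξ j‖ ^ 2 = 1 ∧ c ^ 2 ≤ ∑ i, ‖∑ j, π (A i j) (ξ j)‖ ^ 2 := by
  let I : Type := {q : Σ n : ℕ, Matrix (Fin n) (Fin n) F × ℝ // 0 < q.2.2 ∧
    ∀ r : ℝ, 0 ≤ r → C.Dom q.2.1 ((r : ℂ) • (1 : Matrix (Fin q.1) (Fin q.1) F)) → q.2.2 ≤ r}
  have hrep := fun q : I => exists_rep (C := C) hb (fun b => hb _) q.1.2.1 q.2.1 q.2.2
  choose L i1 i2 i3 π hπ ξ hξ hA using hrep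
  have hbd : ∀ b : F, ∃ R : ℝ, 0 ≤ R ∧ ∀ i x, ‖π i b x‖ ≤ R * ‖x‖ := fun b => by
    obtain ⟨R, a, ha, hab⟩ := hb (Matrix.of fun _ _ : Unit => b)
    have hba : b = (R : ℂ) • a () () := by simpa using congrFun (congrFun hab ()) ()
    refine ⟨|R|, abs_nonneg R, fun i x => ?_⟩
    have := hπ i a ha fun _ => x
    simp only [Finset.univ_unique, Finset.sum_singleton] at this
    rw [hba, map_smul, _root_.smul_apply, norm_smul, Complex.norm_real, Real.norm_eq_abs]
    exact mul_le_mul_of_nonneg_left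
      (abs_le_of_sq_le_sq' this (norm_nonneg _)).2 (abs_nonneg R)
  obtain ⟨ρ, hρ⟩ := exists_algHom_directSum L π hbd
  have hρs : ∀ {ι μ : Type} [Fintype μ] (a : Matrix ι μ F) (x : μ → lp L 2) (i : ι) (q : I),
      (∑ j, ρ (a i j) (x j) : lp L 2) q = ∑ j, π q (a i j) (x j q) := fun a x i q => by
    rw [lp.coeFn_sum, Finset.sum_apply]
    exact Finset.sum_congr rfl fun j _ => hρ _ _ _
  refine ⟨lp L 2, inferInstance, inferInstance, inferInstance, ρ,
    fun {ι μ _ _} a ha x => ?_, fun n A c hc hcA => ?_⟩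
  · refine hasSum_le (fun q => ?_)
      (hasSum_sum fun i _ => hasSum_norm_sq_lp (∑ j, ρ (a i j) (x j) : lp L 2))
      (hasSum_sum fun j _ => hasSum_norm_sq_lp (x j))
    simp_rw [hρs]
    exact hπ q a ha fun j => x j q
  · classical
    let q : I := ⟨⟨n, A, c⟩, hc, hcA⟩
    refine ⟨fun j => lp.single 2 q (ξ q j), ?_, ?_⟩
    · rw [← hξ q]
      exact Finset.sum_congr rfl fun j _ => by rw [lp.norm_single (by norm_num)]
    · refine (hA q).trans (Finset.sum_le_sum fun i _ => ?_)
      refine pow_le_pow_left₀ (norm_nonneg _) ?_ 2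
      refine le_trans (le_of_eq ?_)
        (lp.norm_apply_le_norm (by norm_num)
          (∑ j, ρ (A i j) (lp.single 2 q (ξ q j)) : lp L 2) q)
      rw [hρs]
      simp [q]
end ContractionSystem

end FactorizationSystem

section CommutingFactorization

open Matrix

section MatrixNorms

variable {E : Type} [NormedAddCommGroup E] [InnerProductSpace ℂ E]
  {ι κ : Type} [Fintype ι] [Fintype κ]

theorem opMatCLM_apply (A : Matrix ι κ (E →L[ℂ] E)) (x : PiLp 2 fun _ : κ => E) (i : ι) :
    opMatCLM A x i = ∑ j, A i j (x j) := by
  simp [opMatCLM]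

theorem opMatNorm_nonneg (A : Matrix ι κ (E →L[ℂ] E)) : 0 ≤ opMatNorm A := by
  exact norm_nonneg (opMatCLM A)

theorem sum_norm_sq_le_opMatNorm (A : Matrix ι κ (E →L[ℂ] E)) (x : κ → E) :
    ∑ i, ‖∑ j, A i j (x j)‖ ^ 2 ≤ opMatNorm A ^ 2 * ∑ j, ‖x j‖ ^ 2 := by
  have h := pow_le_pow_left₀ (norm_nonneg _) ((opMatCLM A).le_opNorm (WithLp.toLp 2 x)) 2
  rw [mul_pow, PiLp.norm_sq_eq_of_L2, PiLp.norm_sq_eq_of_L2] at h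
  simp only [opMatCLM_apply] at h
  exact h

theorem opMatNorm_le {A : Matrix ι κ (E →L[ℂ] E)} {R : ℝ} (hR : 0 ≤ R)
    (h : ∀ x : κ → E, ∑ i, ‖∑ j, A i j (x j)‖ ^ 2 ≤ R ^ 2 * ∑ j, ‖x j‖ ^ 2) :
    opMatNorm A ≤ R := by
  refine ContinuousLinearMap.opNorm_le_bound _ hR fun x => ?_
  refine (abs_le_of_sq_le_sq' ?_ (by positivity)).2
  rw [mul_pow, PiLp.norm_sq_eq_of_L2, PiLp.norm_sq_eq_of_L2]
  simpa only [opMatCLM_apply] using h fun j => x j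

theorem opMatNorm_mul_le {μ : Type} [Fintype μ] (A : Matrix ι κ (E →L[ℂ] E))
    (B : Matrix κ μ (E →L[ℂ] E)) : opMatNorm (A * B) ≤ opMatNorm A * opMatNorm B := by
  refine opMatNorm_le (mul_nonneg (opMatNorm_nonneg A) (opMatNorm_nonneg B)) fun x => ?_
  have h1 := sum_norm_sq_le_opMatNorm A fun k => ∑ j, B k j (x j)
  have h2 := mul_le_mul_of_nonneg_left (sum_norm_sq_le_opMatNorm B x) (sq_nonneg (opMatNorm A))
  rw [mul_pow, mul_assoc]
  refine le_trans (le_of_eq (Finset.sum_congr rfl fun i _ => ?_)) (h1.trans h2)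
  congr 2
  simp only [Matrix.mul_apply, _root_.sum_apply, map_sum, mul_apply_eq_comp]
  exact Finset.sum_comm

theorem opMatNorm_smul_le (c : ℂ) (A : Matrix ι κ (E →L[ℂ] E)) :
    opMatNorm (c • A) ≤ ‖c‖ * opMatNorm A := by
  refine opMatNorm_le (mul_nonneg (norm_nonneg c) (opMatNorm_nonneg A)) fun x => ?_
  have h := mul_le_mul_of_nonneg_left (sum_norm_sq_le_opMatNorm A x) (sq_nonneg ‖c‖)
  simpa [← Finset.smul_sum, norm_smul, mul_pow, ← Finset.mul_sum, mul_assoc] using h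

theorem subMatNorm_nonneg {X : Submodule ℂ (E →L[ℂ] E)} (A : Matrix ι κ X) :
    0 ≤ subMatNorm A := opMatNorm_nonneg _

theorem subMatNorm_smul_le {X : Submodule ℂ (E →L[ℂ] E)} (c : ℂ) (A : Matrix ι κ X) :
    subMatNorm (c • A) ≤ ‖c‖ * subMatNorm A := opMatNorm_smul_le c _

theorem subMatNorm_zero {X : Submodule ℂ (E →L[ℂ] E)} :
    subMatNorm (0 : Matrix ι κ X) = 0 := by
  refine le_antisymm ?_ (subMatNorm_nonneg _)
  simpa using subMatNorm_smul_le (0 : ℂ) (0 : Matrix ι κ X)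

theorem subMatNorm_fromBlocks_le {X : Submodule ℂ (E →L[ℂ] E)} {γ : Type} [Fintype γ]
    [DecidableEq γ] {x1 : X} (hx1 : (x1 : E →L[ℂ] E) = 1) {A : Matrix ι κ X}
    (hA : subMatNorm A ≤ 1) :
    subMatNorm (fromBlocks A 0 0 (Matrix.diagonal fun _ : γ => x1)) ≤ 1 := by
  refine opMatNorm_le zero_le_one fun x => ?_
  have h := (sum_norm_sq_le_opMatNorm (A.map fun v => (v : E →L[ℂ] E)) fun j => x (.inl j)).trans
    (mul_le_of_le_one_left (by positivity)
      (pow_le_one₀ (opMatNorm_nonneg _) hA))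
  have hd : ∀ i j : γ, ((Matrix.diagonal (fun _ : γ => x1) i j : X) : E →L[ℂ] E) (x (.inr j))
      = if i = j then x (.inr j) else 0 := fun i j => by
    by_cases hij : i = j <;> simp [Matrix.diagonal, hij, hx1]
  simpa [Fintype.sum_sum_type, hd] using h

theorem subMatNorm_scalar_le {X : Submodule ℂ (E →L[ℂ] E)} {x1 : X}
    (hx1 : (x1 : E →L[ℂ] E) = 1) (u : Matrix ι κ ℂ)
    (hu : ∀ v : κ → ℂ, ∑ i, ‖(u *ᵥ v) i‖ ^ 2 ≤ ∑ j, ‖v j‖ ^ 2) :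
    subMatNorm (u.map fun c => c • x1) ≤ 1 := by
  refine opMatNorm_le zero_le_one fun x => ?_
  simpa [hx1] using sum_norm_sq_smul_le u hu x

end MatrixNorms

section Generators

variable {E₁ E₂ : Type} [NormedAddCommGroup E₁] [InnerProductSpace ℂ E₁]
  [NormedAddCommGroup E₂] [InnerProductSpace ℂ E₂]
  {X : Submodule ℂ (E₁ →L[ℂ] E₁)} {Y : Submodule ℂ (E₂ →L[ℂ] E₂)}
  {F : Type} [Ring F] [Algebra ℂ F] (f : X →ₗ[ℂ] F) (g : Y →ₗ[ℂ] F)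

/-- Products of contractive matrices over `X` and over `Y`, computed in `F`. -/
inductive ContrProd : ∀ {ι κ : Type} [Fintype ι] [Fintype κ], Matrix ι κ F → Prop
  | left {ι κ : Type} [Fintype ι] [Fintype κ] (a : Matrix ι κ X) (h : subMatNorm a ≤ 1) :
      ContrProd (a.map f)
  | right {ι κ : Type} [Fintype ι] [Fintype κ] (a : Matrix ι κ Y) (h : subMatNorm a ≤ 1) :
      ContrProd (a.map g)
  | mul {ι κ μ : Type} [Fintype ι] [Fintype κ] [Fintype μ] {a : Matrix ι κ F}
      {b : Matrix κ μ F} : ContrProd a → ContrProd b → ContrProd (a * b)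

variable {f g} {x1 : X} {y1 : Y} {e : F}

theorem ContrProd.smul_eq (hf : ∀ s, e * f s = f s) (hg : ∀ t, e * g t = g t)
    {ι κ : Type} [Fintype ι] [Fintype κ] {b : Matrix ι κ F} (h : ContrProd f g b) :
    e • b = b := by
  induction h with
  | left a _ => ext i j; exact hf _
  | right a _ => ext i j; exact hg _
  | mul _ _ ha _ => rw [← Matrix.smul_mul, ha]

theorem ContrProd.fromBlocks (hx1 : (x1 : E₁ →L[ℂ] E₁) = 1) (hy1 : (y1 : E₂ →L[ℂ] E₂) = 1)
    (hfe : f x1 = e) (hge : g y1 = e) (hee : e * e = e)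
    {ι κ γ : Type} [Fintype ι] [Fintype κ] [Fintype γ] [DecidableEq γ] {b : Matrix ι κ F}
    (h : ContrProd f g b) :
    ContrProd f g (Matrix.fromBlocks b 0 0 (e • (1 : Matrix γ γ F))) := by
  have hd : e • (1 : Matrix γ γ F) = Matrix.diagonal fun _ => e := by
    rw [← Matrix.diagonal_one, ← Matrix.diagonal_smul]
    simp [Pi.smul_def]
  induction h with
  | left a ha =>
    have := ContrProd.left (f := f) (g := g) _ (subMatNorm_fromBlocks_le (γ := γ) hx1 ha)
    rw [fromBlocks_map, Matrix.diagonal_map (map_zero f)] at this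
    simpa [hd, hfe, Function.comp_def, Matrix.map_zero] using this
  | right a ha =>
    have := ContrProd.right (f := f) (g := g) _ (subMatNorm_fromBlocks_le (γ := γ) hy1 ha)
    rw [fromBlocks_map, Matrix.diagonal_map (map_zero g)] at this
    simpa [hd, hge, Function.comp_def, Matrix.map_zero] using this
  | mul _ _ ha hb =>
    have := ContrProd.mul ha hb
    rw [fromBlocks_multiply] at this
    simpa [smul_smul, hee] using this

theorem smul_mul_smul_of_central {F : Type} [Ring F] {e : F} (he : ∀ x, e * x = x * e)
    (hee : e * e = e) {ι κ μ : Type} [Fintype κ]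
    (a : Matrix ι κ F) (b : Matrix κ μ F) :
    (e • a) * (e • b) = e • (a * b) := by
  ext i k
  simp only [Matrix.mul_apply, Matrix.smul_apply, smul_eq_mul, Finset.mul_sum]
  refine Finset.sum_congr rfl fun j _ => ?_
  rw [mul_assoc, ← mul_assoc (a i j), ← he (a i j), mul_assoc, ← mul_assoc e e, hee]

/-- The contraction system of matrices that become products of contractive matrices over `X`
and `Y` after multiplication by the idempotent `e`. -/
def generatorSystem (hx1 : (x1 : E₁ →L[ℂ] E₁) = 1) (hy1 : (y1 : E₂ →L[ℂ] E₂) = 1)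
    (hfe : f x1 = e) (hge : g y1 = e) (he : ∀ x, e * x = x * e) (hee : e * e = e) :
    ContractionSystem F where
  mem b := ContrProd f g (e • b)
  mul {_ _ _ _ _ _ a b} ha hb := by
    rw [← smul_mul_smul_of_central he hee]
    exact ContrProd.mul ha hb
  diag {_ _ _ _ _ _ _ a} ha := by
    rw [Matrix.fromBlocks_smul, smul_zero, smul_zero]
    exact ContrProd.fromBlocks hx1 hy1 hfe hge hee ha
  scalar {_ _ _ _} u hu := by
    have := ContrProd.left (f := f) (g := g) _ (subMatNorm_scalar_le hx1 u hu)
    convert this using 1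
    ext i j
    simp [hfe, Algebra.smul_def, he]

namespace ContractionSystem

variable {C : ContractionSystem F}

theorem exists_dom_one_add {ι κ : Type} [Fintype ι] [Fintype κ] [DecidableEq κ]
    {a b : Matrix ι κ F} (ha : ∃ R : ℝ, C.Dom a ((R : ℂ) • (1 : Matrix κ κ F)))
    (hb : ∃ R : ℝ, C.Dom b ((R : ℂ) • (1 : Matrix κ κ F))) :
    ∃ R : ℝ, C.Dom (a + b) ((R : ℂ) • (1 : Matrix κ κ F)) := by
  obtain ⟨R, hR⟩ := ha
  obtain ⟨Q, hQ⟩ := hb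
  have h0 : 0 ≤ R ^ 2 + Q ^ 2 := by positivity
  have h1 : C.Dom (fromRows a b) ((√(R ^ 2 + Q ^ 2) : ℂ) • (1 : Matrix κ κ F)) :=
    (hR.fromRows hQ).trans (Dom.of_rowQuad_le fun f => by
      rw [rowQuad_fromRows, rowQuad_smul, rowQuad_smul, rowQuad_smul, Real.sq_sqrt h0, add_mul])
  have h2 : C.Dom (a + b) ((√2 : ℂ) • fromRows a b) := Dom.of_rowQuad_le fun f => by
    rw [rowQuad_smul, rowQuad_fromRows, Real.sq_sqrt zero_le_two]
    simp only [rowQuad, ← Finset.sum_add_distrib, Finset.mul_sum]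
    refine Finset.sum_le_sum fun i _ => ?_
    have h3 : f ((a + b) i) = f (a i) + f (b i) := map_add f (a i) (b i)
    have h4 := pow_le_pow_left₀ (norm_nonneg _) (norm_add_le (f (a i)) (f (b i))) 2
    rw [h3]
    nlinarith [sq_nonneg (‖f (a i)‖ - ‖f (b i)‖)]
  exact ⟨_, h2.trans (h1.real_smul (r := √2))⟩

theorem exists_dom_one_mul {ι κ μ : Type} [Fintype ι] [Fintype κ] [Fintype μ] [DecidableEq κ]
    [DecidableEq μ] {a : Matrix ι κ F} {b : Matrix κ μ F}
    (ha : ∃ R : ℝ, C.Dom a ((R : ℂ) • (1 : Matrix κ κ F)))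
    (hb : ∃ R : ℝ, C.Dom b ((R : ℂ) • (1 : Matrix μ μ F))) :
    ∃ R : ℝ, C.Dom (a * b) ((R : ℂ) • (1 : Matrix μ μ F)) := by
  obtain ⟨R, c, hc, rfl⟩ := ha
  obtain ⟨Q, hQ⟩ := hb
  refine ⟨_, Dom.trans (y := (R : ℂ) • b) ⟨c, hc, ?_⟩ (hQ.real_smul (r := R))⟩
  rw [Matrix.mul_assoc, Matrix.smul_mul, Matrix.one_mul]

/-- If the single-entry matrices over a generating set are bounded, then all matrices are. -/
theorem exists_dom_one {s : Set F} (hs : Algebra.adjoin ℂ s = ⊤)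
    (hgen : ∀ x ∈ s, ∀ {ι κ : Type} [Fintype ι] [Fintype κ] [DecidableEq ι] [DecidableEq κ]
      (i : ι) (j : κ), ∃ R : ℝ, C.Dom (Matrix.single i j x) ((R : ℂ) • (1 : Matrix κ κ F)))
    {ι κ : Type} [Fintype ι] [Fintype κ] [DecidableEq κ] (a : Matrix ι κ F) :
    ∃ R : ℝ, C.Dom a ((R : ℂ) • (1 : Matrix κ κ F)) := by
  classical
  have hsingle : ∀ x : F, ∀ (ι κ : Type) [Fintype ι] [Fintype κ] [DecidableEq ι] [DecidableEq κ]
      (i : ι) (j : κ), ∃ R : ℝ,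
        C.Dom (Matrix.single i j x) ((R : ℂ) • (1 : Matrix κ κ F)) := fun x => by
    have hx : x ∈ Algebra.adjoin ℂ s := hs ▸ Algebra.mem_top
    induction hx using Algebra.adjoin_induction with
    | mem x hx => exact fun ι κ _ _ _ _ => hgen x hx
    | algebraMap c =>
      intro ι κ _ _ _ _ i j
      refine ⟨‖c‖, Dom.of_rowQuad_le fun f => ?_⟩
      have h1 : ∀ i', f (Matrix.single i j (algebraMap ℂ F c) i')
          = if i' = i then c * f ((1 : Matrix κ κ F) j) else 0 := fun i' => by
        by_cases h : i' = i
        · have h2 : Matrix.single i j (algebraMap ℂ F c) i = c • (1 : Matrix κ κ F) j := by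
            funext k
            simp [Matrix.single_apply, Matrix.one_apply, Algebra.algebraMap_eq_smul_one]
          rw [h, h2, map_smul, if_pos rfl, smul_eq_mul]
        · have h2 : Matrix.single i j (algebraMap ℂ F c) i' = 0 := by
            funext k
            simp [Ne.symm h]
          rw [h2, map_zero, if_neg h]
      have h2 : rowQuad (Matrix.single i j (algebraMap ℂ F c)) f
          = ‖c‖ ^ 2 * ‖f ((1 : Matrix κ κ F) j)‖ ^ 2 := by
        rw [rowQuad, Finset.sum_eq_single i]
        · rw [h1, if_pos rfl, norm_mul, mul_pow]
        · intro b _ hb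
          rw [h1, if_neg hb]; simp
        · simp
      rw [h2, rowQuad_smul]
      refine mul_le_mul_of_nonneg_left ?_ (by positivity)
      exact Finset.single_le_sum (f := fun j => ‖f ((1 : Matrix κ κ F) j)‖ ^ 2)
        (fun _ _ => by positivity) (Finset.mem_univ j)
    | add x y _ _ hx hy =>
      intro ι κ _ _ _ _ i j
      rw [Matrix.single_add]
      exact exists_dom_one_add (hx ι κ i j) (hy ι κ i j)
    | mul x y _ _ hx hy =>
      intro ι κ _ _ _ _ i j
      have := exists_dom_one_mul (hx ι Unit i ()) (hy Unit κ () j)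
      rwa [Matrix.single_mul_single_same] at this
  rw [Matrix.matrix_eq_sum_single a]
  refine Finset.sum_induction _ (fun b => ∃ R : ℝ, C.Dom b ((R : ℂ) • (1 : Matrix κ κ F)))
    (fun _ _ => exists_dom_one_add) ⟨0, Dom.of_rowQuad_le fun f => ?_⟩ fun i _ => ?_
  · refine le_of_eq_of_le ?_ (rowQuad_nonneg _ f)
    exact Finset.sum_eq_zero fun i _ => by
      have : f ((0 : Matrix ι κ F) i) = 0 := map_zero f
      rw [this]; simp
  · refine Finset.sum_induction _ (fun b => ∃ R : ℝ, C.Dom b ((R : ℂ) • (1 : Matrix κ κ F)))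
      (fun _ _ => exists_dom_one_add) ⟨0, Dom.of_rowQuad_le fun f => ?_⟩
      fun j _ => hsingle _ ι κ i j
    refine le_of_eq_of_le ?_ (rowQuad_nonneg _ f)
    exact Finset.sum_eq_zero fun i _ => by
      have : f ((0 : Matrix ι κ F) i) = 0 := map_zero f
      rw [this]; simp

end ContractionSystem

theorem subMatNorm_inv_smul_le {E : Type} [NormedAddCommGroup E] [InnerProductSpace ℂ E]
    {X : Submodule ℂ (E →L[ℂ] E)} {ι κ : Type} [Fintype ι] [Fintype κ] (a : Matrix ι κ X) {r : ℝ}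
    (hr : 0 < r) (ha : subMatNorm a ≤ r) : subMatNorm (((r⁻¹ : ℝ) : ℂ) • a) ≤ 1 := by
  refine (subMatNorm_smul_le _ _).trans ?_
  rw [Complex.norm_real, Real.norm_of_nonneg (inv_nonneg.2 hr.le), inv_mul_le_iff₀ hr, mul_one]
  exact ha

theorem map_eq_smul_map_inv_smul {X : Type} [AddCommGroup X] [Module ℂ X] (f : X →ₗ[ℂ] F)
    {ι κ : Type} (a : Matrix ι κ X) {r : ℝ} (hr : 0 < r) :
    a.map f = (r : ℂ) • (((r⁻¹ : ℝ) : ℂ) • a).map f := by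
  ext i j
  rw [Matrix.smul_apply, Matrix.map_apply, Matrix.map_apply, Matrix.smul_apply, map_smul, smul_smul,
    ← Complex.ofReal_mul, mul_inv_cancel₀ hr.ne', Complex.ofReal_one, one_smul]

/-- The algebra generated by `X` and `Y` has a representation that is completely contractive on
`X` and on `Y` and that detects all matrices that are not small multiples of products of
contractions over `X` and `Y`. -/
theorem exists_rep_of_generators (hx1 : (x1 : E₁ →L[ℂ] E₁) = 1) (hy1 : (y1 : E₂ →L[ℂ] E₂) = 1)
    (hfe : f x1 = e) (hge : g y1 = e) (hf : ∀ x, e * f x = f x) (hg : ∀ y, e * g y = g y)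
    (hf' : ∀ x, f x * e = f x) (hg' : ∀ y, g y * e = g y)
    (hgen : Algebra.adjoin ℂ (Set.range f ∪ Set.range g) = ⊤) :
    ∃ (L : Type) (_ : NormedAddCommGroup L) (_ : InnerProductSpace ℂ L) (_ : CompleteSpace L)
      (π : F →ₐ[ℂ] (L →L[ℂ] L)), π e = 1 ∧
      (∀ {ι κ : Type} [Fintype ι] [Fintype κ] (a : Matrix ι κ X),
        opMatNorm (a.map fun x => π (f x)) ≤ subMatNorm a) ∧
      (∀ {ι κ : Type} [Fintype ι] [Fintype κ] (a : Matrix ι κ Y),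
        opMatNorm (a.map fun y => π (g y)) ≤ subMatNorm a) ∧
      ∀ (n : ℕ) (A : Matrix (Fin n) (Fin n) F) (c : ℝ), e • A = A → 0 < c →
        (∀ (r : ℝ) (b : Matrix (Fin n) (Fin n) F), 0 ≤ r → ContrProd f g b → A = (r : ℂ) • b →
          c ≤ r) → c ≤ opMatNorm (A.map π) := by
  have hee : e * e = e := by
    have := hf x1
    rwa [hfe] at this
  have he : ∀ x, e * x = x * e := fun x => by
    have hx : x ∈ Algebra.adjoin ℂ (Set.range f ∪ Set.range g) := hgen ▸ Algebra.mem_top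
    induction hx using Algebra.adjoin_induction with
    | mem x hx =>
      rcases hx with ⟨x, rfl⟩ | ⟨x, rfl⟩
      · rw [hf, hf']
      · rw [hg, hg']
    | algebraMap c => exact (Algebra.commutes c e).symm
    | add x y _ _ hx hy => rw [mul_add, add_mul, hx, hy]
    | mul x y _ _ hx hy => rw [← mul_assoc, hx, mul_assoc, hy, mul_assoc]
  let C : ContractionSystem F := generatorSystem hx1 hy1 hfe hge he hee
  have hmem : ∀ {ι κ : Type} [Fintype ι] [Fintype κ] {b : Matrix ι κ F},
      ContrProd f g b → C.mem b := fun {ι κ _ _ b} h => by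
    change ContrProd f g (e • b)
    rwa [h.smul_eq hf hg]
  have hdomf : ∀ {ι κ : Type} [Fintype ι] [Fintype κ] [DecidableEq κ] (a : Matrix ι κ X),
      ∃ R : ℝ, C.Dom (a.map f) ((R : ℂ) • (1 : Matrix κ κ F)) := fun {ι κ _ _ _} a => by
    have hr : 0 < subMatNorm a + 1 := by linarith [subMatNorm_nonneg a]
    refine ⟨subMatNorm a + 1, _, hmem (ContrProd.left _
      (subMatNorm_inv_smul_le a hr (by linarith))), ?_⟩
    rw [Matrix.mul_smul, Matrix.mul_one]
    exact map_eq_smul_map_inv_smul f a hr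
  have hdomg : ∀ {ι κ : Type} [Fintype ι] [Fintype κ] [DecidableEq κ] (a : Matrix ι κ Y),
      ∃ R : ℝ, C.Dom (a.map g) ((R : ℂ) • (1 : Matrix κ κ F)) := fun {ι κ _ _ _} a => by
    have hr : 0 < subMatNorm a + 1 := by linarith [subMatNorm_nonneg a]
    refine ⟨subMatNorm a + 1, _, hmem (ContrProd.right _
      (subMatNorm_inv_smul_le a hr (by linarith))), ?_⟩
    rw [Matrix.mul_smul, Matrix.mul_one]
    exact map_eq_smul_map_inv_smul g a hr
  obtain ⟨L, i1, i2, i3, π, hπ, hA⟩ := C.exists_universal_rep fun a =>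
    ContractionSystem.exists_dom_one hgen (by
      rintro x (⟨x, rfl⟩ | ⟨x, rfl⟩) ι κ _ _ _ _ i j
      · simpa using hdomf (Matrix.single i j x)
      · simpa using hdomg (Matrix.single i j x)) a
  have hcontr : ∀ {ι κ : Type} [Fintype ι] [Fintype κ] {b : Matrix ι κ F},
      C.mem b → opMatNorm (b.map π) ≤ 1 := fun {ι κ _ _ b} h =>
    opMatNorm_le zero_le_one fun x => by simpa using hπ b h x
  have hscale : ∀ {ι κ : Type} [Fintype ι] [Fintype κ] {b : Matrix ι κ F} {r : ℝ}, 0 < r →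
      C.mem b → opMatNorm (((r : ℂ) • b).map π) ≤ r := fun {ι κ _ _ b r} hr h => by
    have h1 : ((r : ℂ) • b).map π = (r : ℂ) • b.map π := by
      ext1 i j
      exact map_smul π _ _
    rw [h1]
    refine (opMatNorm_smul_le _ _).trans ?_
    rw [Complex.norm_real, Real.norm_of_nonneg hr.le]
    exact mul_le_of_le_one_right hr.le (hcontr h)
  refine ⟨L, i1, i2, i3, π, ?_, fun {ι κ _ _} a => ?_, fun {ι κ _ _} a => ?_,
    fun n A c heA hc hcA => ?_⟩
  · have hsub : π (1 - e) = 0 := by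
      ext x
      by_contra hx
      have hx' : 0 < ‖π (1 - e) x‖ := norm_pos_iff.2 hx
      obtain ⟨n, hn⟩ := exists_nat_gt (‖x‖ / ‖π (1 - e) x‖)
      rw [div_lt_iff₀ hx'] at hn
      have hz : C.mem (Matrix.of fun _ _ : Unit => (n : F) * (1 - e)) := by
        have h0 := ContrProd.left (f := f) (g := g) (0 : Matrix Unit Unit X)
          (subMatNorm_zero.le.trans zero_le_one)
        change ContrProd f g (e • Matrix.of fun _ _ : Unit => (n : F) * (1 - e))
        convert h0 using 1
        ext i j
        simp [he, mul_assoc, sub_mul, hee]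
      have h1 := hπ _ hz fun _ => x
      simp only [Finset.univ_unique, Finset.sum_singleton, Matrix.of_apply] at h1
      have h2 := (abs_le_of_sq_le_sq' h1 (norm_nonneg _)).2
      rw [map_mul, map_natCast, mul_apply_eq_comp] at h2
      have h3 : ((n : L →L[ℂ] L)) (π (1 - e) x) = (n : ℂ) • π (1 - e) x := by
        rw [← nsmul_one]
        simp [Nat.cast_smul_eq_nsmul]
      rw [h3, norm_smul, Complex.norm_natCast] at h2
      linarith
    rw [map_sub, map_one, sub_eq_zero] at hsub
    exact hsub.symm
  · refine le_of_forall_gt_imp_ge_of_dense fun r hr => ?_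
    have hr0 := (subMatNorm_nonneg a).trans_lt hr
    have := hscale hr0 (hmem (ContrProd.left _ (subMatNorm_inv_smul_le a hr0 hr.le)))
    rwa [← map_eq_smul_map_inv_smul f a hr0] at this
  · refine le_of_forall_gt_imp_ge_of_dense fun r hr => ?_
    have hr0 := (subMatNorm_nonneg a).trans_lt hr
    have := hscale hr0 (hmem (ContrProd.right _ (subMatNorm_inv_smul_le a hr0 hr.le)))
    rwa [← map_eq_smul_map_inv_smul g a hr0] at this
  · obtain ⟨ξ, hξ, hle⟩ := hA n A c hc fun r hr ⟨a, ha, hAa⟩ => by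
      refine hcA r (e • a) hr ha ?_
      rw [← heA, hAa, Matrix.mul_smul, Matrix.mul_one, smul_comm]
    have := sum_norm_sq_le_opMatNorm (A.map π) ξ
    rw [hξ, mul_one] at this
    exact (abs_le_of_sq_le_sq' (hle.trans this) (opMatNorm_nonneg _)).2
end Generators

section PathProduct

variable {R : Type*} [Semiring R]

/-- The product of a chain of matrices, as a sum over paths. -/
def pathProd {N : ℕ} (d : Fin (N + 1) → ℕ)
    (m : ∀ i : Fin N, Matrix (Fin (d i.castSucc)) (Fin (d i.succ)) R) :
    Matrix (Fin (d 0)) (Fin (d (Fin.last N))) R :=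
  Matrix.of fun i j =>
    ∑ p ∈ Finset.univ.filter (fun p : ∀ t, Fin (d t) => p 0 = i ∧ p (Fin.last N) = j),
      (List.ofFn fun t : Fin N => m t (p t.castSucc) (p t.succ)).prod

theorem pathProd_zero (d : Fin 1 → ℕ)
    (m : ∀ i : Fin 0, Matrix (Fin (d i.castSucc)) (Fin (d i.succ)) R) :
    pathProd d m = (1 : Matrix (Fin (d 0)) (Fin (d 0)) R) := by
  ext i j
  have h : Finset.univ.filter (fun p : ∀ t, Fin (d t) => p 0 = i ∧ p (Fin.last 0) = j)
      = if i = j then {fun t => Fin.cast (by rw [Subsingleton.elim t 0]) i} else ∅ := by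
    ext p
    split_ifs with hij
    · subst hij
      simp only [Finset.mem_filter, Finset.mem_univ, true_and, Finset.mem_singleton]
      refine ⟨fun h => funext fun t => ?_, fun h => ?_⟩
      · obtain rfl := Subsingleton.elim t 0
        exact h.1
      · subst h
        exact ⟨rfl, rfl⟩
    · simp only [Finset.mem_filter, Finset.mem_univ, true_and, Finset.notMem_empty, iff_false]
      rintro ⟨rfl, rfl⟩
      exact hij rfl
  simp only [pathProd, Matrix.of_apply, h, Matrix.one_apply]
  split_ifs <;> simp

theorem pathProd_succ_apply {N : ℕ} (d : Fin (N + 1 + 1) → ℕ)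
    (m : ∀ i : Fin (N + 1), Matrix (Fin (d i.castSucc)) (Fin (d i.succ)) R) (i : Fin (d 0))
    (j : Fin (d (Fin.last (N + 1)))) :
    pathProd d m i j = ∑ k : Fin (d (Fin.succ 0)),
      m 0 i k * pathProd (fun i => d i.succ) (fun i => m i.succ) k j := by
  classical
  have hR : ∀ k : Fin (d (Fin.succ 0)),
      m 0 i k * pathProd (fun i => d i.succ) (fun i => m i.succ) k j
      = ∑ q : ∀ t : Fin (N + 1), Fin (d t.succ), if q 0 = k then
        (if q (Fin.last N) = j then m 0 i k *
          (List.ofFn fun t : Fin N => m t.succ (q t.castSucc) (q t.succ)).prod else 0) else 0 :=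
    fun k => by
      simp only [pathProd, Matrix.of_apply, Finset.sum_filter, Finset.mul_sum, ite_and, mul_ite,
        mul_zero]
  have hL : pathProd d m i j = ∑ x : Fin (d 0) × ∀ t : Fin (N + 1), Fin (d t.succ),
      if x.1 = i then (if x.2 (Fin.last N) = j then m 0 i (x.2 0) *
          (List.ofFn fun t : Fin N => m t.succ (x.2 t.castSucc) (x.2 t.succ)).prod else 0)
        else 0 := by
    simp only [pathProd, Matrix.of_apply, Finset.sum_filter, ite_and]
    refine (Fintype.sum_equiv (Fin.consEquiv fun t => Fin (d t)) _ _ ?_).symm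
    rintro ⟨a, q⟩
    by_cases ha : a = i
    · subst ha
      rw [List.ofFn_succ, List.prod_cons]
      rfl
    · exact (if_neg ha).trans (if_neg ha).symm
  rw [hL, Fintype.sum_prod_type, Finset.sum_eq_single i (fun k _ hk => by simp [hk]) (by simp)]
  simp only [hR]
  rw [Finset.sum_comm]
  refine Finset.sum_congr rfl fun q _ => Eq.symm ?_
  refine (Fintype.sum_eq_single (q 0) fun k hk => ?_).trans (if_pos rfl)
  exact if_neg (Ne.symm hk)

theorem pathProd_succ {N : ℕ} (d : Fin (N + 1 + 1) → ℕ)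
    (m : ∀ i : Fin (N + 1), Matrix (Fin (d i.castSucc)) (Fin (d i.succ)) R)
    (a : Matrix (Fin (d 0)) (Fin (d (Fin.succ 0))) R)
    (b : Matrix (Fin (d (Fin.succ 0))) (Fin (d (Fin.last (N + 1)))) R) (ha : m 0 = a)
    (hb : (pathProd (fun i => d i.succ) fun i => m i.succ) = b) : pathProd d m = a * b := by
  subst ha hb
  ext i j
  exact pathProd_succ_apply d m i j

theorem opMatNorm_map_pathProd_le {F L : Type} [Ring F] [Algebra ℂ F] [NormedAddCommGroup L]
    [InnerProductSpace ℂ L] (π : F →ₐ[ℂ] (L →L[ℂ] L)) {N : ℕ} (d : Fin (N + 1) → ℕ)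
    (m : ∀ i : Fin N, Matrix (Fin (d i.castSucc)) (Fin (d i.succ)) F) :
    opMatNorm ((pathProd d m).map π) ≤ ∏ i, opMatNorm ((m i).map π) := by
  induction N with
  | zero =>
    rw [pathProd_zero]
    refine opMatNorm_le (by simp) fun x => ?_
    change ∑ i : Fin (d 0), ‖∑ j : Fin (d 0), π ((1 : Matrix (Fin (d 0)) (Fin (d 0)) F) i j) (x j)‖
      ^ 2 ≤ _
    have h : ∀ i j, π ((1 : Matrix (Fin (d 0)) (Fin (d 0)) F) i j) (x j)
        = if i = j then x j else 0 := fun i j => by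
      by_cases h : i = j
      · rw [h, Matrix.one_apply_eq, map_one, if_pos rfl]
        rfl
      · rw [Matrix.one_apply_ne h, map_zero, if_neg h]
        rfl
    simp [h]
  | succ N ih =>
    have h : (pathProd d m).map π = _ :=
      congrArg (fun a => Matrix.map a π) (pathProd_succ d m _ _ rfl rfl)
    rw [h, Fin.prod_univ_succ]
    refine (congrArg opMatNorm Matrix.map_mul).trans_le ?_
    exact (opMatNorm_mul_le _ _).trans
      (mul_le_mul_of_nonneg_left (ih _ _) (opMatNorm_nonneg _))

end PathProduct

section ComFactorizations

set_option linter.unusedSectionVars false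

variable {S T} {s1 : S} {t1 : T}

/-- The norm of a matrix over `S ⊗ ℂ1_T` or over `ℂ1_S ⊗ T`. -/
def sideNorm (s1 : S) (t1 : T) {ι κ : Type} [Fintype ι] [Fintype κ] (b : Bool)
    (M : Matrix ι κ (S ⊗[ℂ] T)) : ℝ :=
  if b then subMatNorm (M.map (sliceS S T t1)) else subMatNorm (M.map (sliceT S T s1))

theorem sideNorm_nonneg {ι κ : Type} [Fintype ι] [Fintype κ] (b : Bool)
    (M : Matrix ι κ (S ⊗[ℂ] T)) : 0 ≤ sideNorm s1 t1 b M := by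
  unfold sideNorm
  split_ifs <;> exact subMatNorm_nonneg _

theorem ComFact.cost_nonneg {n k : ℕ} (C : ComFact S T s1 t1 n k) : 0 ≤ C.cost S T :=
  Finset.prod_nonneg fun i _ => sideNorm_nonneg (C.sides i) (C.mats i)

theorem exists_comFact_cons {R : Type*} [Semiring R] (φ : S ⊗[ℂ] T → R) {N : ℕ}
    (d : Fin (N + 1) → ℕ)
    (m : ∀ i : Fin N, Matrix (Fin (d i.castSucc)) (Fin (d i.succ)) (S ⊗[ℂ] T))
    (sides : Fin N → Bool)
    (mem : ∀ (i : Fin N) r c,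
      if sides i then m i r c ∈ leftSlice S T t1 else m i r c ∈ rightSlice S T s1)
    {l : ℕ} (b : Bool) (M : Matrix (Fin l) (Fin (d 0)) (S ⊗[ℂ] T))
    (hM : ∀ r c, if b then M r c ∈ leftSlice S T t1 else M r c ∈ rightSlice S T s1) :
    ∃ C : ComFact S T s1 t1 l (d (Fin.last N)),
      C.prodIn S T φ = M.map φ * pathProd d (fun i => (m i).map φ) ∧
      C.cost S T = sideNorm s1 t1 b M * ∏ i, sideNorm s1 t1 (sides i) (m i) := by
  let C : ComFact S T s1 t1 l (d (Fin.last N)) :=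
    { len := N + 1
      pos := Nat.le_add_left 1 N
      dims := Fin.cons (α := fun _ => ℕ) l d
      dim_first := rfl
      dim_last := rfl
      mats := Fin.cases M m
      sides := Fin.cons (α := fun _ => Bool) b sides
      mem := Fin.cases hM mem }
  refine ⟨C, ?_, ?_⟩
  · exact pathProd_succ (R := R) C.dims (fun i => (C.mats i).map φ) _ _ rfl rfl
  · exact Fin.prod_univ_succ (fun i : Fin (N + 1) => sideNorm s1 t1 (C.sides i) (C.mats i))

variable (s1 t1) in
/-- `B` is the image of a factorization of cost at most `c`. -/
def HasFact {n k : ℕ} (B : Matrix (Fin n) (Fin k) (ComFreeAlg S T s1 t1)) (c : ℝ) : Prop :=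
  ∃ C : ComFact S T s1 t1 n k, C.prodIn S T (comEmb S T s1 t1) = B ∧ C.cost S T ≤ c

theorem hasFact_single {n k : ℕ} (b : Bool) (M : Matrix (Fin n) (Fin k) (S ⊗[ℂ] T))
    (hM : ∀ r c, if b then M r c ∈ leftSlice S T t1 else M r c ∈ rightSlice S T s1) {c : ℝ}
    (hc : sideNorm s1 t1 b M ≤ c) : HasFact s1 t1 (M.map (comEmb S T s1 t1)) c := by
  obtain ⟨C, hC, hcost⟩ := exists_comFact_cons (comEmb S T s1 t1) (N := 0) (fun _ => k)
    (fun i => i.elim0) (fun i => i.elim0) (fun i => i.elim0) b M hM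
  refine ⟨C, ?_, ?_⟩
  · rw [hC, pathProd_zero]
    exact Matrix.mul_one _
  · rw [hcost]
    simpa using hc

theorem HasFact.mul {n k l : ℕ} {B : Matrix (Fin n) (Fin k) (ComFreeAlg S T s1 t1)} {c : ℝ}
    (h : HasFact s1 t1 B c) (b : Bool) (M : Matrix (Fin l) (Fin n) (S ⊗[ℂ] T))
    (hM : ∀ r c, if b then M r c ∈ leftSlice S T t1 else M r c ∈ rightSlice S T s1) {c' : ℝ}
    (hc : sideNorm s1 t1 b M ≤ c') :
    HasFact s1 t1 (M.map (comEmb S T s1 t1) * B) (c' * c) := by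
  obtain ⟨⟨N, hN, d, rfl, rfl, m, sides, mem⟩, rfl, hcost⟩ := h
  obtain ⟨C, hC, hcost'⟩ := exists_comFact_cons (comEmb S T s1 t1) d m sides mem b M hM
  refine ⟨C, hC, ?_⟩
  rw [hcost']
  exact mul_le_mul hc hcost (Finset.prod_nonneg fun i _ => sideNorm_nonneg _ _)
    ((sideNorm_nonneg _ _).trans hc)

theorem opMatNorm_map_le_sideNorm {R L : Type} [NormedAddCommGroup L] [InnerProductSpace ℂ L]
    (φ : S ⊗[ℂ] T → R) (π : R → (L →L[ℂ] L))
    (hS : ∀ {ι κ : Type} [Fintype ι] [Fintype κ] (a : Matrix ι κ S),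
      opMatNorm (a.map fun s => π (φ (s ⊗ₜ t1))) ≤ subMatNorm a)
    (hT : ∀ {ι κ : Type} [Fintype ι] [Fintype κ] (a : Matrix ι κ T),
      opMatNorm (a.map fun t => π (φ (s1 ⊗ₜ t))) ≤ subMatNorm a)
    {ι κ : Type} [Fintype ι] [Fintype κ] (b : Bool) (M : Matrix ι κ (S ⊗[ℂ] T))
    (hM : ∀ r c, if b then M r c ∈ leftSlice S T t1 else M r c ∈ rightSlice S T s1) :
    opMatNorm ((M.map φ).map π) ≤ sideNorm s1 t1 b M := by
  cases b
  · refine le_of_eq_of_le (congrArg opMatNorm ?_) (hT (M.map (sliceT S T s1)))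
    ext1 r c
    have h1 : ∃ t : T, s1 ⊗ₜ[ℂ] t = M r c := hM r c
    simp only [Matrix.map_apply, sliceT, dif_pos h1, h1.choose_spec]
  · refine le_of_eq_of_le (congrArg opMatNorm ?_) (hS (M.map (sliceS S T t1)))
    ext1 r c
    have h1 : ∃ s : S, s ⊗ₜ[ℂ] t1 = M r c := hM r c
    simp only [Matrix.map_apply, sliceS, dif_pos h1, h1.choose_spec]

theorem opMatNorm_prodIn_le {F L : Type} [Ring F] [Algebra ℂ F] [NormedAddCommGroup L]
    [InnerProductSpace ℂ L] (φ : S ⊗[ℂ] T → F) (π : F →ₐ[ℂ] (L →L[ℂ] L))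
    (hS : ∀ {ι κ : Type} [Fintype ι] [Fintype κ] (a : Matrix ι κ S),
      opMatNorm (a.map fun s => π (φ (s ⊗ₜ t1))) ≤ subMatNorm a)
    (hT : ∀ {ι κ : Type} [Fintype ι] [Fintype κ] (a : Matrix ι κ T),
      opMatNorm (a.map fun t => π (φ (s1 ⊗ₜ t))) ≤ subMatNorm a)
    {n k : ℕ} (C : ComFact S T s1 t1 n k) :
    opMatNorm ((C.prodIn S T φ).map π) ≤ C.cost S T := by
  obtain ⟨N, hN, d, rfl, rfl, m, sides, mem⟩ := C
  exact (opMatNorm_map_pathProd_le π d fun i => (m i).map φ).trans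
    (Finset.prod_le_prod (fun _ _ => opMatNorm_nonneg _) fun i _ =>
      opMatNorm_map_le_sideNorm φ π hS hT (sides i) (m i) (mem i))

theorem comNorm_le_of_hasFact {n k : ℕ} {A : Matrix (Fin n) (Fin k) (S ⊗[ℂ] T)} {c : ℝ}
    (h : HasFact s1 t1 (A.map (comEmb S T s1 t1)) c) : comNorm S T s1 t1 A ≤ c := by
  obtain ⟨C, hC, hcost⟩ := h
  have h0 : BddBelow {r : ℝ | ∃ C : ComFact S T s1 t1 n k,
      C.prodIn S T (comEmb S T s1 t1) = A.map (comEmb S T s1 t1) ∧ r = C.cost S T} := by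
    refine ⟨0, ?_⟩
    rintro _ ⟨C, -, rfl⟩
    exact ComFact.cost_nonneg C
  exact (csInf_le h0 ⟨C, hC, rfl⟩).trans hcost

end ComFactorizations

section CommutingEmbedding

set_option linter.unusedSectionVars false

theorem tmul_left_injective {V W : Type} [AddCommGroup V] [Module ℂ V] [AddCommGroup W]
    [Module ℂ W] {w : W} (hw : w ≠ 0) : Function.Injective fun v : V => v ⊗ₜ[ℂ] w := by
  intro v v' h
  obtain ⟨φ, hφ⟩ := not_forall.1 ((Module.forall_dual_apply_eq_zero_iff ℂ w).not.2 hw)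
  have h1 := congrArg (TensorProduct.rid ℂ V ∘ φ.lTensor V) h
  simp only [Function.comp_apply, LinearMap.lTensor_tmul, TensorProduct.rid_tmul] at h1
  exact smul_right_injective V hφ h1

theorem tmul_right_injective {V W : Type} [AddCommGroup V] [Module ℂ V] [AddCommGroup W]
    [Module ℂ W] {v : V} (hv : v ≠ 0) : Function.Injective fun w : W => v ⊗ₜ[ℂ] w :=
  fun _ _ h => tmul_left_injective hv (congrArg (TensorProduct.comm ℂ V W) h)

variable {S T} {s1 : S} {t1 : T}

theorem sliceS_tmul (ht1 : t1 ≠ 0) (s : S) : sliceS S T t1 (s ⊗ₜ t1) = s := by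
  have h : ∃ s' : S, s' ⊗ₜ[ℂ] t1 = s ⊗ₜ t1 := ⟨s, rfl⟩
  rw [sliceS, dif_pos h]
  exact tmul_left_injective ht1 h.choose_spec

theorem sliceT_tmul (hs1 : s1 ≠ 0) (t : T) : sliceT S T s1 (s1 ⊗ₜ t) = t := by
  have h : ∃ t' : T, s1 ⊗ₜ[ℂ] t' = s1 ⊗ₜ t := ⟨t, rfl⟩
  rw [sliceT, dif_pos h]
  exact tmul_right_injective hs1 h.choose_spec

variable (s1 t1)

/-- The canonical map `S ⊗ T → F_m(S ⊗ T)` as a linear map. -/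
def comLin : S ⊗[ℂ] T →ₗ[ℂ] ComFreeAlg S T s1 t1 :=
  (RingQuot.mkAlgHom ℂ (comRel S T s1 t1)).toLinearMap ∘ₗ TensorAlgebra.ι ℂ

/-- The embedding `s ↦ s ⊗ 1_T` of `S` into `F_m(S ⊗ T)`. -/
def leftGen : S →ₗ[ℂ] ComFreeAlg S T s1 t1 :=
  comLin s1 t1 ∘ₗ (TensorProduct.mk ℂ S T).flip t1

/-- The embedding `t ↦ 1_S ⊗ t` of `T` into `F_m(S ⊗ T)`. -/
def rightGen : T →ₗ[ℂ] ComFreeAlg S T s1 t1 :=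
  comLin s1 t1 ∘ₗ TensorProduct.mk ℂ S T s1

variable {s1 t1}

theorem one_mul_comLin (x : S ⊗[ℂ] T) :
    comLin s1 t1 (s1 ⊗ₜ t1) * comLin s1 t1 x = comLin s1 t1 x := by
  have h := RingQuot.mkAlgHom_rel ℂ (s := comRel S T s1 t1) (Or.inl ⟨1, x, rfl, rfl⟩)
  rw [one_smul, one_smul, map_mul] at h
  exact h

theorem comLin_mul_one (x : S ⊗[ℂ] T) :
    comLin s1 t1 x * comLin s1 t1 (s1 ⊗ₜ t1) = comLin s1 t1 x := by
  have h := RingQuot.mkAlgHom_rel ℂ (s := comRel S T s1 t1) (Or.inr (Or.inl ⟨1, x, rfl, rfl⟩))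
  rw [one_smul, one_smul, map_mul] at h
  exact h

theorem leftGen_mul_rightGen (s : S) (t : T) :
    leftGen s1 t1 s * rightGen s1 t1 t = comLin s1 t1 (s ⊗ₜ t) := by
  have h := RingQuot.mkAlgHom_rel ℂ (s := comRel S T s1 t1)
    (Or.inr (Or.inr (Or.inl ⟨s, t, rfl, rfl⟩)))
  rw [map_mul] at h
  exact h

theorem rightGen_mul_leftGen (s : S) (t : T) :
    rightGen s1 t1 t * leftGen s1 t1 s = comLin s1 t1 (s ⊗ₜ t) := by
  have h := RingQuot.mkAlgHom_rel ℂ (s := comRel S T s1 t1)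
    (Or.inr (Or.inr (Or.inr ⟨s, t, rfl, rfl⟩)))
  rw [map_mul] at h
  exact h

theorem adjoin_range_gen :
    Algebra.adjoin ℂ (Set.range (leftGen s1 t1) ∪ Set.range (rightGen s1 t1)) = ⊤ := by
  have h : (⊤ : Subalgebra ℂ (ComFreeAlg S T s1 t1))
      = Algebra.adjoin ℂ
        (RingQuot.mkAlgHom ℂ (comRel S T s1 t1) '' Set.range (TensorAlgebra.ι ℂ)) := by
    rw [← AlgHom.map_adjoin, TensorAlgebra.adjoin_range_ι, Algebra.map_top,
      (AlgHom.range_eq_top _).2 (RingQuot.mkAlgHom_surjective ℂ _)]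
  rw [eq_top_iff, h]
  refine Algebra.adjoin_le ?_
  rintro _ ⟨_, ⟨x, rfl⟩, rfl⟩
  change comLin s1 t1 x ∈ _
  induction x using TensorProduct.induction_on with
  | zero => rw [map_zero]; exact zero_mem _
  | tmul s t =>
    rw [← leftGen_mul_rightGen]
    exact mul_mem (Algebra.subset_adjoin (Or.inl ⟨s, rfl⟩))
      (Algebra.subset_adjoin (Or.inr ⟨t, rfl⟩))
  | add x y hx hy => rw [map_add]; exact add_mem hx hy

theorem subMatNorm_submatrix_le {E : Type} [NormedAddCommGroup E] [InnerProductSpace ℂ E]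
    {X : Submodule ℂ (E →L[ℂ] E)} {ι κ ι' κ' : Type} [Fintype ι] [Fintype κ] [Fintype ι']
    [Fintype κ'] (A : Matrix ι κ X) (e₁ : ι' ≃ ι) (e₂ : κ' ≃ κ) :
    subMatNorm (A.submatrix e₁ e₂) ≤ subMatNorm A := by
  refine opMatNorm_le (subMatNorm_nonneg A) fun x => ?_
  have h := sum_norm_sq_le_opMatNorm (A.map fun v => (v : E →L[ℂ] E)) fun j => x (e₂.symm j)
  rw [← e₁.sum_comp, ← e₂.sum_comp fun j => ‖x (e₂.symm j)‖ ^ 2] at h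
  simp only [← e₂.sum_comp fun j => _, Equiv.symm_apply_apply] at h
  exact h

/-- A reindexed product of contractions has a factorization of cost at most one, and multiplying
by it does not increase the cost of a factorization. -/
theorem ContrProd.hasFact (hs1 : s1 ≠ 0) (ht1 : t1 ≠ 0) {ι κ : Type} [Fintype ι] [Fintype κ]
    {b : Matrix ι κ (ComFreeAlg S T s1 t1)} (hb : ContrProd (leftGen s1 t1) (rightGen s1 t1) b)
    {n k : ℕ} (e₁ : Fin n ≃ ι) (e₂ : Fin k ≃ κ) :
    HasFact s1 t1 (b.submatrix e₁ e₂) 1 ∧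
      ∀ (l : ℕ) (B : Matrix (Fin k) (Fin l) (ComFreeAlg S T s1 t1)) (c : ℝ),
        HasFact s1 t1 B c → HasFact s1 t1 (b.submatrix e₁ e₂ * B) c := by
  induction hb generalizing n k with
  | left a ha =>
    let M : Matrix (Fin n) (Fin k) (S ⊗[ℂ] T) := (a.submatrix e₁ e₂).map fun s => s ⊗ₜ t1
    have hM : ∀ r c, if true then M r c ∈ leftSlice S T t1 else M r c ∈ rightSlice S T s1 :=
      fun r c => ⟨_, rfl⟩
    have hc : sideNorm s1 t1 true M ≤ 1 := by
      refine le_trans (le_of_eq ?_) ((subMatNorm_submatrix_le a e₁ e₂).trans ha)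
      refine congrArg subMatNorm ?_
      ext1 i j
      exact sliceS_tmul ht1 _
    refine ⟨hasFact_single true M hM hc, fun l B c h => ?_⟩
    have := h.mul true M hM hc
    rwa [one_mul] at this
  | right a ha =>
    let M : Matrix (Fin n) (Fin k) (S ⊗[ℂ] T) := (a.submatrix e₁ e₂).map fun t => s1 ⊗ₜ t
    have hM : ∀ r c, if false then M r c ∈ leftSlice S T t1 else M r c ∈ rightSlice S T s1 :=
      fun r c => ⟨_, rfl⟩
    have hc : sideNorm s1 t1 false M ≤ 1 := by
      refine le_trans (le_of_eq ?_) ((subMatNorm_submatrix_le a e₁ e₂).trans ha)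
      refine congrArg subMatNorm ?_
      ext1 i j
      exact sliceT_tmul hs1 _
    refine ⟨hasFact_single false M hM hc, fun l B c h => ?_⟩
    have := h.mul false M hM hc
    rwa [one_mul] at this
  | @mul ι κ μ _ _ _ a b _ _ iha ihb =>
    have hab := Matrix.submatrix_mul_equiv a b e₁ (Fintype.equivFin κ).symm e₂
    rw [← hab]
    refine ⟨(iha _ _).2 _ _ _ (ihb _ _).1, fun l B c h => ?_⟩
    rw [Matrix.mul_assoc]
    exact (iha _ _).2 _ _ _ ((ihb _ _).2 _ _ _ h)

theorem hasFact_of_eq_smul (hs1 : s1 ≠ 0) (ht1 : t1 ≠ 0) (hs1' : (s1 : H →L[ℂ] H) = 1)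
    {n : ℕ} {A : Matrix (Fin n) (Fin n) (S ⊗[ℂ] T)} {r : ℝ} (hr : 0 ≤ r)
    {b : Matrix (Fin n) (Fin n) (ComFreeAlg S T s1 t1)}
    (hb : ContrProd (leftGen s1 t1) (rightGen s1 t1) b)
    (hA : A.map (comLin s1 t1) = (r : ℂ) • b) : HasFact s1 t1 (A.map (comEmb S T s1 t1)) r := by
  let a : Matrix (Fin n) (Fin n) S := (r : ℂ) • Matrix.diagonal fun _ => s1
  let M : Matrix (Fin n) (Fin n) (S ⊗[ℂ] T) := a.map fun s => s ⊗ₜ t1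
  have hM : ∀ r c, if true then M r c ∈ leftSlice S T t1 else M r c ∈ rightSlice S T s1 :=
    fun r c => ⟨_, rfl⟩
  have hd : subMatNorm (Matrix.diagonal fun _ : Fin n => s1) ≤ 1 := by
    refine opMatNorm_le zero_le_one fun x => ?_
    have h : ∀ i j, (((Matrix.diagonal fun _ : Fin n => s1) i j : S) : H →L[ℂ] H) (x j)
        = if i = j then x j else 0 := fun i j => by
      by_cases hij : i = j <;> simp [Matrix.diagonal, hij, hs1']
    simp [h]
  have hc : sideNorm s1 t1 true M ≤ r := by
    have h1 : M.map (sliceS S T t1) = a := by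
      ext1 i j
      exact sliceS_tmul ht1 _
    change subMatNorm (M.map (sliceS S T t1)) ≤ r
    rw [h1]
    refine (subMatNorm_smul_le _ _).trans ?_
    rw [Complex.norm_real, Real.norm_of_nonneg hr]
    exact mul_le_of_le_one_right hr hd
  have h := ((hb.hasFact hs1 ht1 (Equiv.refl _) (Equiv.refl _)).1).mul true M hM hc
  rw [mul_one] at h
  convert h using 1
  refine hA.trans ?_
  have h2 : M.map (comEmb S T s1 t1)
      = (r : ℂ) • Matrix.diagonal fun _ : Fin n => comLin s1 t1 (s1 ⊗ₜ t1) := by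
    change a.map (leftGen s1 t1) = _
    ext1 i j
    by_cases hij : i = j
    · simp [a, hij, leftGen]
    · simp [a, hij]
  have h3 := hb.smul_eq (e := comLin s1 t1 (s1 ⊗ₜ t1)) (fun s => one_mul_comLin _)
    (fun t => one_mul_comLin _)
  rw [h2, Matrix.smul_mul]
  refine congrArg ((r : ℂ) • ·) (h3.symm.trans ?_)
  ext1 i j
  exact (Matrix.diagonal_mul (fun _ => comLin s1 t1 (s1 ⊗ₜ t1)) b i j).symm

end CommutingEmbedding

section Adjoint

set_option linter.unusedSectionVars false

variable {E L : Type} [NormedAddCommGroup E] [InnerProductSpace ℂ E] [CompleteSpace E]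
  [NormedAddCommGroup L] [InnerProductSpace ℂ L] [CompleteSpace L]
  {X : Submodule ℂ (E →L[ℂ] E)}

theorem opMatNorm_of_unit_le (a : E →L[ℂ] E) : opMatNorm (Matrix.of fun _ _ : Unit => a) ≤ ‖a‖ := by
  refine opMatNorm_le (norm_nonneg a) fun x => ?_
  simpa [mul_pow] using pow_le_pow_left₀ (norm_nonneg _) (a.le_opNorm (x ())) 2

theorem norm_le_opMatNorm_of_unit (a : E →L[ℂ] E) :
    ‖a‖ ≤ opMatNorm (Matrix.of fun _ _ : Unit => a) := by
  refine a.opNorm_le_bound (opMatNorm_nonneg _) fun x => ?_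
  have h := sum_norm_sq_le_opMatNorm (Matrix.of fun _ _ : Unit => a) fun _ => x
  simp only [Finset.univ_unique, Finset.sum_singleton, Matrix.of_apply, ← mul_pow] at h
  exact (abs_le_of_sq_le_sq' h (mul_nonneg (opMatNorm_nonneg _) (norm_nonneg x))).2

/-- A complete contraction is a contraction. -/
theorem norm_le_of_opMatNorm_map_le (ψ : X → (L →L[ℂ] L))
    (h : ∀ {ι κ : Type} [Fintype ι] [Fintype κ] (a : Matrix ι κ X),
      opMatNorm (a.map ψ) ≤ subMatNorm a) (x : X) : ‖ψ x‖ ≤ ‖(x : E →L[ℂ] E)‖ :=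
  (norm_le_opMatNorm_of_unit _).trans
    ((h (Matrix.of fun _ _ : Unit => x)).trans (opMatNorm_of_unit_le (x : E →L[ℂ] E)))

theorem norm_add_I_smul_one_sq_le {a : E →L[ℂ] E} (ha : star a = a) (t : ℝ) :
    ‖a + ((t : ℂ) * Complex.I) • (1 : E →L[ℂ] E)‖ ^ 2 ≤ ‖a‖ ^ 2 + t ^ 2 := by
  have h1 : star (a + ((t : ℂ) * Complex.I) • (1 : E →L[ℂ] E))
      * (a + ((t : ℂ) * Complex.I) • (1 : E →L[ℂ] E)) = a * a + ((t ^ 2 : ℝ) : ℂ) • 1 := by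
    have h2 : ((t : ℂ) * Complex.I) * ((t : ℂ) * Complex.I) = -((t ^ 2 : ℝ) : ℂ) := by
      push_cast
      linear_combination (t : ℂ) ^ 2 * Complex.I_mul_I
    have h3 : star ((t : ℂ) * Complex.I) = -((t : ℂ) * Complex.I) := by
      simp
    rw [star_add, star_smul, star_one, ha, h3, add_mul, mul_add, mul_add, smul_mul_assoc,
      smul_mul_assoc, one_mul, one_mul, mul_smul_comm, mul_one, smul_smul, neg_mul, h2, neg_neg,
      neg_smul]
    abel
  rw [sq, ← CStarRing.norm_star_mul_self, h1]
  refine (norm_add_le _ _).trans (add_le_add ((norm_mul_le a a).trans_eq (sq _).symm) ?_)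
  rw [norm_smul, Complex.norm_real, Real.norm_of_nonneg (sq_nonneg t)]
  exact mul_le_of_le_one_right (sq_nonneg t) ContinuousLinearMap.norm_id_le

/-- A unital contractive map sends self-adjoint elements to self-adjoint elements. -/
theorem star_map_of_star_eq (ψ : X →ₗ[ℂ] (L →L[ℂ] L)) {x1 : X} (hx1 : (x1 : E →L[ℂ] E) = 1)
    (hψ1 : ψ x1 = 1) (hψ : ∀ x, ‖ψ x‖ ≤ ‖(x : E →L[ℂ] E)‖) {x : X}
    (hx : star (x : E →L[ℂ] E) = x) : star (ψ x) = ψ x := by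
  refine ContinuousLinearMap.isSelfAdjoint_iff_isSymmetric.2 ?_
  refine (LinearMap.isSymmetric_iff_inner_map_self_real _).2 fun v => ?_
  rw [Complex.conj_eq_iff_im]
  set w : ℂ := inner ℂ (ψ x v) v with hw
  have key : ∀ t : ℝ, 2 * t * w.im ≤ ‖(x : E →L[ℂ] E)‖ ^ 2 * ‖v‖ ^ 2 := fun t => by
    have h1 : ‖ψ (x + ((-t : ℝ) * Complex.I) • x1) v‖ ^ 2
        ≤ (‖(x : E →L[ℂ] E)‖ ^ 2 + (-t) ^ 2) * ‖v‖ ^ 2 := by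
      refine (pow_le_pow_left₀ (norm_nonneg _) (ContinuousLinearMap.le_opNorm _ v) 2).trans ?_
      rw [mul_pow]
      refine mul_le_mul_of_nonneg_right ?_ (sq_nonneg _)
      refine (pow_le_pow_left₀ (norm_nonneg _) (hψ _) 2).trans ?_
      have := norm_add_I_smul_one_sq_le hx (-t)
      rwa [← hx1] at this
    have h2 : ψ (x + ((-t : ℝ) * Complex.I) • x1) v = ψ x v + ((-t : ℝ) * Complex.I) • v := by
      rw [map_add, map_smul, hψ1]
      rfl
    have h3 : RCLike.re (inner ℂ (ψ x v) (((-t : ℝ) * Complex.I) • v)) = t * w.im := by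
      rw [inner_smul_right, ← hw]
      simp
    have h4 : ‖((-t : ℝ) * Complex.I) • v‖ ^ 2 = t ^ 2 * ‖v‖ ^ 2 := by
      rw [norm_smul, norm_mul, Complex.norm_I, mul_one, Complex.norm_real, mul_pow,
        Real.norm_eq_abs, sq_abs, neg_sq]
    rw [h2, norm_add_sq (𝕜 := ℂ), h3, h4] at h1
    nlinarith [sq_nonneg ‖ψ x v‖]
  by_contra hne
  have h := key ((‖(x : E →L[ℂ] E)‖ ^ 2 * ‖v‖ ^ 2 + 1) / (2 * w.im))
  have h' : (‖(x : E →L[ℂ] E)‖ ^ 2 * ‖v‖ ^ 2 + 1) / (2 * w.im) * (2 * w.im)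
      = ‖(x : E →L[ℂ] E)‖ ^ 2 * ‖v‖ ^ 2 + 1 := div_mul_cancel₀ _ (mul_ne_zero two_ne_zero hne)
  linarith

/-- A unital contractive map on an operator system preserves adjoints. -/
theorem star_map_of_contractive (hX : ∀ a : E →L[ℂ] E, a ∈ X → star a ∈ X)
    (ψ : X →ₗ[ℂ] (L →L[ℂ] L)) {x1 : X} (hx1 : (x1 : E →L[ℂ] E) = 1)
    (hψ1 : ψ x1 = 1) (hψ : ∀ x, ‖ψ x‖ ≤ ‖(x : E →L[ℂ] E)‖) (x : X) :
    star (ψ x) = ψ ⟨star (x : E →L[ℂ] E), hX _ x.2⟩ := by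
  set y : X := ⟨star (x : E →L[ℂ] E), hX _ x.2⟩ with hy
  have h1 := star_map_of_star_eq ψ hx1 hψ1 hψ (x := x + y) (by simp [hy, add_comm])
  have h2 := star_map_of_star_eq ψ hx1 hψ1 hψ (x := Complex.I • (x - y)) (by
    simp [hy, ← smul_neg])
  rw [map_add, star_add] at h1
  rw [map_smul, star_smul, map_sub, star_sub, Complex.star_def, Complex.conj_I, neg_smul,
    ← smul_neg] at h2
  have h3 := smul_right_injective (L →L[ℂ] L) Complex.I_ne_zero h2
  have h4 : (2 : ℂ) • star (ψ x) = (2 : ℂ) • ψ y := by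
    rw [two_smul, two_smul]
    have h5 := congrArg₂ (· - ·) h1 h3
    rw [show star (ψ x) + star (ψ y) - -(star (ψ x) - star (ψ y))
      = star (ψ x) + star (ψ x) by abel] at h5
    rw [h5]
    abel
  exact smul_right_injective (L →L[ℂ] L) two_ne_zero h4

end Adjoint

section DegenerateCase

set_option linter.unusedSectionVars false

variable {S T} {s1 : S} {t1 : T}

theorem comNorm_nonneg {n k : ℕ} (A : Matrix (Fin n) (Fin k) (S ⊗[ℂ] T)) :
    0 ≤ comNorm S T s1 t1 A :=
  Real.sInf_nonneg (by
    rintro _ ⟨C, -, rfl⟩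
    exact ComFact.cost_nonneg C)

theorem subsingleton_of_one_eq_zero {E : Type} [NormedAddCommGroup E] [InnerProductSpace ℂ E]
    {X : Submodule ℂ (E →L[ℂ] E)} {x1 : X} (hx1 : (x1 : E →L[ℂ] E) = 1) (h : x1 = 0) :
    Subsingleton X := by
  have h0 : (1 : E →L[ℂ] E) = 0 := by rw [← hx1, h]; rfl
  refine subsingleton_of_forall_eq 0 fun x => Subtype.ext ?_
  rw [← mul_one (x : E →L[ℂ] E), h0, mul_zero]
  rfl

theorem comNorm_eq_zero (hs1 : (s1 : H →L[ℂ] H) = 1) (ht1 : (t1 : K →L[ℂ] K) = 1)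
    (h : s1 = 0 ∨ t1 = 0) {n k : ℕ} (A : Matrix (Fin n) (Fin k) (S ⊗[ℂ] T)) :
    comNorm S T s1 t1 A = 0 := by
  have hA : A = 0 := by
    ext1 i j
    induction A i j using TensorProduct.induction_on with
    | zero => rfl
    | tmul s t =>
      rcases h with h | h
      · have := subsingleton_of_one_eq_zero hs1 h
        rw [Subsingleton.elim s 0, TensorProduct.zero_tmul]
        rfl
      · have := subsingleton_of_one_eq_zero ht1 h
        rw [Subsingleton.elim t 0, TensorProduct.tmul_zero]
        rfl
    | add x y hx hy => rw [hx, hy]; exact add_zero _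
  refine le_antisymm (comNorm_le_of_hasFact ?_) (comNorm_nonneg A)
  subst hA
  rcases h with h | h
  · have := subsingleton_of_one_eq_zero hs1 h
    refine hasFact_single true _ (fun _ _ => zero_mem (leftSlice S T t1)) (le_of_eq ?_)
    exact (congrArg subMatNorm (Subsingleton.elim _ 0)).trans subMatNorm_zero
  · have := subsingleton_of_one_eq_zero ht1 h
    refine hasFact_single false _ (fun _ _ => zero_mem (rightSlice S T s1)) (le_of_eq ?_)
    exact (congrArg subMatNorm (Subsingleton.elim _ 0)).trans subMatNorm_zero

end DegenerateCase

end CommutingFactorization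

/-- **Representation of the commuting factorization norms.**  Let `S ⊆ B(H)` and `T ⊆ B(K)`
be operator systems and equip the algebraic tensor product `S ⊗ T` with the factorization
norms `‖·‖ᶜ` of the commuting partial product.  Then there are a Hilbert space `L` and a
linear map `π : S ⊗ T → B(L)` which is unital, completely isometric for `‖·‖ᶜ`, multiplies
`π(s ⊗ t) = π(s ⊗ 1)π(1 ⊗ t) = π(1 ⊗ t)π(s ⊗ 1)`, and is compatible with the adjoint:
`π(s ⊗ t)* = π(s* ⊗ t*)`. -/
theorem comNorm_representation
    (hS1 : (1 : H →L[ℂ] H) ∈ S) (hT1 : (1 : K →L[ℂ] K) ∈ T)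
    (hSstar : ∀ a : H →L[ℂ] H, a ∈ S → star a ∈ S)
    (hTstar : ∀ a : K →L[ℂ] K, a ∈ T → star a ∈ T) :
    ∃ (L : Type) (_ : NormedAddCommGroup L) (_ : InnerProductSpace ℂ L) (_ : CompleteSpace L)
      (π : (↥S ⊗[ℂ] ↥T) →ₗ[ℂ] (L →L[ℂ] L)),
      π ((⟨1, hS1⟩ : ↥S) ⊗ₜ[ℂ] (⟨1, hT1⟩ : ↥T)) = 1 ∧
      (∀ (n : ℕ) (A : Matrix (Fin n) (Fin n) (↥S ⊗[ℂ] ↥T)),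
        opMatNorm (A.map ⇑π) = comNorm S T ⟨1, hS1⟩ ⟨1, hT1⟩ A) ∧
      (∀ (s : ↥S) (t : ↥T),
        π (s ⊗ₜ[ℂ] t) = π (s ⊗ₜ[ℂ] (⟨1, hT1⟩ : ↥T)) * π ((⟨1, hS1⟩ : ↥S) ⊗ₜ[ℂ] t) ∧
        π (s ⊗ₜ[ℂ] t) = π ((⟨1, hS1⟩ : ↥S) ⊗ₜ[ℂ] t) * π (s ⊗ₜ[ℂ] (⟨1, hT1⟩ : ↥T))) ∧
      (∀ (s : ↥S) (t : ↥T),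
        star (π (s ⊗ₜ[ℂ] t)) =
          π ((⟨star (s : H →L[ℂ] H), hSstar _ s.2⟩ : ↥S) ⊗ₜ[ℂ]
             (⟨star (t : K →L[ℂ] K), hTstar _ t.2⟩ : ↥T))) := by
  set s1 : S := ⟨1, hS1⟩ with hs1_def
  set t1 : T := ⟨1, hT1⟩ with ht1_def
  by_cases h : s1 = 0 ∨ t1 = 0
  · refine ⟨EuclideanSpace ℂ (Fin 0), inferInstance, inferInstance, inferInstance, 0,
      Subsingleton.elim _ _, fun n A => ?_,
      fun s t => ⟨Subsingleton.elim _ _, Subsingleton.elim _ _⟩, fun s t => Subsingleton.elim _ _⟩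
    rw [comNorm_eq_zero rfl rfl h]
    refine le_antisymm (opMatNorm_le le_rfl fun x => ?_) (opMatNorm_nonneg _)
    simp
  obtain ⟨hs1, ht1⟩ := not_or.1 h
  obtain ⟨L, _, _, _, π, hπe, hπS, hπT, hπ⟩ := exists_rep_of_generators (x1 := s1) (y1 := t1)
    (f := leftGen s1 t1) (g := rightGen s1 t1) (e := comLin s1 t1 (s1 ⊗ₜ t1)) rfl rfl rfl rfl
    (fun _ => one_mul_comLin _) (fun _ => one_mul_comLin _) (fun _ => comLin_mul_one _)
    (fun _ => comLin_mul_one _) adjoin_range_gen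
  have hmul : ∀ (s : S) (t : T), π (comLin s1 t1 (s ⊗ₜ t))
      = π (leftGen s1 t1 s) * π (rightGen s1 t1 t) := fun s t => by
    rw [← leftGen_mul_rightGen, map_mul]
  have hmul' : ∀ (s : S) (t : T), π (comLin s1 t1 (s ⊗ₜ t))
      = π (rightGen s1 t1 t) * π (leftGen s1 t1 s) := fun s t => by
    rw [← rightGen_mul_leftGen, map_mul]
  refine ⟨L, inferInstance, inferInstance, inferInstance, π.toLinearMap ∘ₗ comLin s1 t1, hπe,
    fun n A => ?_, fun s t => ⟨hmul s t, hmul' s t⟩, fun s t => ?_⟩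
  · have hlow : ∀ c, 0 < c → (∀ (r : ℝ) (b : Matrix (Fin n) (Fin n) (ComFreeAlg S T s1 t1)),
        0 ≤ r → ContrProd (leftGen s1 t1) (rightGen s1 t1) b →
        A.map (comLin s1 t1) = (r : ℂ) • b → c ≤ r) →
        c ≤ opMatNorm ((A.map (comLin s1 t1)).map π) := fun c =>
      hπ n (A.map (comLin s1 t1)) c (by ext1 i j; exact one_mul_comLin _)
    change opMatNorm ((A.map (comLin s1 t1)).map π) = _
    refine le_antisymm ?_ ?_
    · obtain ⟨r, b, hr, hb, hA⟩ : ∃ (r : ℝ) (b : Matrix (Fin n) (Fin n) (ComFreeAlg S T s1 t1)),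
          0 ≤ r ∧ ContrProd (leftGen s1 t1) (rightGen s1 t1) b ∧
          A.map (comLin s1 t1) = (r : ℂ) • b := by
        by_contra hne
        have := hlow (opMatNorm ((A.map (comLin s1 t1)).map π) + 1)
          (by linarith [opMatNorm_nonneg ((A.map (comLin s1 t1)).map π)])
          fun r b hr hb hA => absurd ⟨r, b, hr, hb, hA⟩ hne
        linarith
      obtain ⟨C, hC, -⟩ := hasFact_of_eq_smul hs1 ht1 rfl hr hb hA
      refine le_csInf ⟨_, C, hC, rfl⟩ ?_
      rintro _ ⟨C, hC, rfl⟩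
      refine le_of_eq_of_le ?_ (opMatNorm_prodIn_le (comEmb S T s1 t1) π hπS hπT C)
      rw [hC]
      rfl
    · rcases (comNorm_nonneg A).eq_or_lt with h0 | h0
      · rw [← h0]
        exact opMatNorm_nonneg _
      · exact hlow _ h0 fun r b hr hb hA =>
          comNorm_le_of_hasFact (hasFact_of_eq_smul hs1 ht1 rfl hr hb hA)
  · change star (π (comLin s1 t1 (s ⊗ₜ t))) = π (comLin s1 t1 (_ ⊗ₜ _))
    rw [hmul', hmul, star_mul]
    exact congrArg₂ (· * ·)
      (star_map_of_contractive hSstar (π.toLinearMap ∘ₗ leftGen s1 t1) (x1 := s1) rfl hπe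
        (norm_le_of_opMatNorm_map_le _ hπS) s)
      (star_map_of_contractive hTstar (π.toLinearMap ∘ₗ rightGen s1 t1) (x1 := t1) rfl hπe
        (norm_le_of_opMatNorm_map_le _ hπT) t)
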